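/- Fix τ > 0 and a function N ↦ K(N) ∈ ℕ with K(N)/N → τ as N → ∞. For each N let μ_1, …, μ_{K(N)} be independent random probability vectors, each uniformly distributed on the simplex Λ_N, let G be their K(N) × K(N) Gram matrix G_{ij} = A(μ_i, μ_j), with eigenvalues λ_1, …, λ_{K(N)}, and let ρ_{K(N)} = (1/K(N)) ∑_{i=1}^{K(N)} δ_{λ_i} be the empirical eigenvalue distribution. Then the expectation of ρ_{K(N)} converges weakly, as N → ∞, to the Marchenko–Pastur distribution with parameter τ scaled by a = 1 − π/4; that is, for every bounded continuous function f : ℝ → ℝ, E(∫ f dρ_{K(N)}) → ∫ f(a x) dρ_MP(x; τ). -/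

import Mathlib

open MeasureTheory

/-- The uniform probability measure on the simplex `Λ_N`, i.e. the normalized
Lebesgue (Hausdorff) measure on the standard simplex in `ℝ^N`. -/
noncomputable def uniformSimplex (N : ℕ) : Measure (Fin N → ℝ) :=
  (μH[(N : ℝ) - 1] (stdSimplex ℝ (Fin N)))⁻¹ •
    (μH[(N : ℝ) - 1]).restrict (stdSimplex ℝ (Fin N))

/-- The affinity `A(μ, ν) = ∑_α √(μ_α ν_α)` of two probability vectors. -/
noncomputable def affinity {N : ℕ} (μ ν : Fin N → ℝ) : ℝ :=
  ∑ α, Real.sqrt (μ α * ν α)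

/-- The Gram matrix `[A(μ_i, μ_j)]_{i,j}` of a family of probability vectors. -/
noncomputable def gramMatrix {N K : ℕ} (μ : Fin K → (Fin N → ℝ)) :
    Matrix (Fin K) (Fin K) ℝ :=
  Matrix.of fun i j => affinity (μ i) (μ j)

lemma gramMatrix_isHermitian {N K : ℕ} (μ : Fin K → (Fin N → ℝ)) :
    (gramMatrix μ).IsHermitian := by
  ext i j
  simp only [Matrix.conjTranspose_apply, gramMatrix, Matrix.of_apply, star_trivial, affinity]
  exact Finset.sum_congr rfl fun α _ => by rw [mul_comm]

/-- The density of the Marchenko–Pastur distribution with parameter `τ`. -/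
noncomputable def mpDensity (τ x : ℝ) : ℝ :=
  if (1 - Real.sqrt τ) ^ 2 ≤ x ∧ x ≤ (1 + Real.sqrt τ) ^ 2 then
    Real.sqrt (4 * τ * x - (x + τ - 1) ^ 2) / (2 * Real.pi * τ * x)
  else 0

/-- The Marchenko–Pastur distribution with parameter `τ`: for `τ > 1` it has an atom
of mass `(τ-1)/τ` at `0`, and it has density `mpDensity τ` with respect to Lebesgue
measure. -/
noncomputable def mpMeasure (τ : ℝ) : Measure ℝ :=
  (if 1 < τ then ENNReal.ofReal ((τ - 1) / τ) • Measure.dirac (0 : ℝ) else 0) +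
    volume.withDensity fun x => ENNReal.ofReal (mpDensity τ x)


section PartSimplex

theorem aux_lintegral_pi_prod (n : ℕ) (P : Measure ℝ) [SigmaFinite P]
    (f : Fin n → ℝ → ENNReal) (hf : ∀ i, Measurable (f i)) :
    ∫⁻ x, ∏ i, f i (x i) ∂(Measure.pi fun _ : Fin n => P) = ∏ i, ∫⁻ t, f i t ∂P := by
  induction n with
  | zero => simp
  | succ n ih =>
    have h := (measurePreserving_piFinSuccAbove (fun _ : Fin (n+1) => P) 0)
    have e : (fun x : Fin (n+1) → ℝ => ∏ i, f i (x i)) =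
      fun x => (fun p : ℝ × (Fin n → ℝ) => f 0 p.1 * ∏ i, f i.succ (p.2 i))
        (MeasurableEquiv.piFinSuccAbove (fun _ => ℝ) 0 x) := by
      funext x
      simp [Fin.prod_univ_succ, MeasurableEquiv.piFinSuccAbove_apply, Fin.insertNthEquiv, Fin.tail]
    rw [e]
    refine (h.lintegral_comp_emb (MeasurableEquiv.measurableEmbedding _)
      (fun p : ℝ × (Fin n → ℝ) => f 0 p.1 * ∏ i, f i.succ (p.2 i))).trans ?_
    refine (lintegral_prod_mul (μ := P) (ν := Measure.pi fun _ : Fin n => P) (f := f 0) (g := fun y : Fin n → ℝ => ∏ i, f i.succ (y i)) ?_ ?_).trans ?_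
    · exact (hf 0).aemeasurable
    · exact Measurable.aemeasurable (Finset.measurable_prod _ fun i _ => (hf _).comp (measurable_pi_apply i))
    · rw [Fin.prod_univ_succ]
      congr 1
      exact ih (fun i => f i.succ) (fun i => hf _)

theorem aux_pi_withDensity (n : ℕ) (d : ℝ → ENNReal) (hd : Measurable d)
    [SigmaFinite (volume.withDensity d)] :
    (Measure.pi fun _ : Fin n => (volume : Measure ℝ).withDensity d) =
      (volume : Measure (Fin n → ℝ)).withDensity (fun x => ∏ i, d (x i)) := by
  refine Measure.pi_eq fun s hs => ?_
  rw [withDensity_apply _ (MeasurableSet.univ_pi hs), ← lintegral_indicator (MeasurableSet.univ_pi hs)]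
  have : (Set.pi Set.univ s).indicator (fun x : Fin n → ℝ => ∏ i, d (x i)) =
      fun x => ∏ i, (s i).indicator d (x i) := by
    funext x
    by_cases hx : x ∈ Set.pi Set.univ s
    · rw [Set.indicator_of_mem hx]
      refine Finset.prod_congr rfl fun i _ => ?_
      rw [Set.indicator_of_mem (hx i trivial)]
    · rw [Set.indicator_of_notMem hx]
      simp only [Set.mem_pi, Set.mem_univ, true_implies, not_forall] at hx
      obtain ⟨i, hi⟩ := hx
      exact (Finset.prod_eq_zero (Finset.mem_univ i) (Set.indicator_of_notMem hi _)).symm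
  rw [this, volume_pi, aux_lintegral_pi_prod n volume _ (fun i => hd.indicator (hs i))]
  refine Finset.prod_congr rfl fun i _ => ?_
  rw [lintegral_indicator (hs i), withDensity_apply _ (hs i)]

/-- chart of the hyperplane -/
noncomputable def simpChart (n : ℕ) (t : Fin n → ℝ) : Fin (n+1) → ℝ :=
  Fin.cons (1 - ∑ i, t i) t

theorem simpChart_cont (n : ℕ) : Continuous (simpChart n) := by
  unfold simpChart
  refine continuous_pi fun i => ?_
  refine Fin.cases ?_ (fun j => ?_) i
  · simp only [Fin.cons_zero]; fun_prop
  · simp only [Fin.cons_succ]; fun_prop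

theorem simpChart_anti (n : ℕ) : AntilipschitzWith 1 (simpChart n) := by
  refine AntilipschitzWith.of_le_mul_dist fun x y => ?_
  simp only [NNReal.coe_one, one_mul]
  refine (dist_pi_le_iff dist_nonneg).2 fun i => ?_
  have := dist_le_pi_dist (simpChart n x) (simpChart n y) i.succ
  simpa [simpChart] using this

theorem simpChart_lip (n : ℕ) : LipschitzWith (n+1) (simpChart n) := by
  refine LipschitzWith.of_dist_le_mul fun x y => ?_
  refine (dist_pi_le_iff (by positivity)).2 fun i => ?_
  have h0 : ∀ j, dist (x j) (y j) ≤ dist x y := fun j => dist_le_pi_dist x y j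
  have hd : 0 ≤ dist x y := dist_nonneg
  refine Fin.cases ?_ (fun j => ?_) i
  · simp only [simpChart, Fin.cons_zero]
    calc dist (1 - ∑ i, x i) (1 - ∑ i, y i) = |∑ i, (y i - x i)| := by
          rw [Real.dist_eq, Finset.sum_sub_distrib]; congr 1; ring
      _ ≤ ∑ i, |y i - x i| := Finset.abs_sum_le_sum_abs _ _
      _ ≤ ∑ i : Fin n, dist x y := Finset.sum_le_sum fun i _ => by
          have := h0 i; rwa [Real.dist_eq, abs_sub_comm] at this
      _ ≤ _ := by simp; nlinarith
  · simp only [simpChart, Fin.cons_succ]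
    refine (h0 j).trans ?_
    push_cast
    nlinarith [mul_nonneg (Nat.cast_nonneg (α := ℝ) n) hd]

theorem simpChart_emb (n : ℕ) : MeasurableEmbedding (simpChart n) :=
  ((simpChart_anti n).isClosedEmbedding (simpChart_lip n).uniformContinuous).measurableEmbedding

theorem simpChart_range (n : ℕ) : stdSimplex ℝ (Fin (n+1)) ⊆ Set.range (simpChart n) := by
  intro x hx
  refine ⟨Fin.tail x, ?_⟩
  have := hx.2
  rw [Fin.sum_univ_succ] at this
  unfold simpChart
  have h2 : 1 - ∑ i, Fin.tail x i = x 0 := by simp only [Fin.tail]; linarith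
  rw [h2, Fin.cons_self_tail]

theorem aux_hausdorff (n : ℕ) : ∃ c : NNReal, c ≠ 0 ∧
    (μH[(n:ℝ)] : Measure (Fin (n+1) → ℝ)).comap (simpChart n) = c • (volume : Measure (Fin n → ℝ)) := by
  set ν := (μH[(n:ℝ)] : Measure (Fin (n+1) → ℝ)).comap (simpChart n) with hν
  have hvol : (μH[(n:ℝ)] : Measure (Fin n → ℝ)) = volume := by
    have := hausdorffMeasure_pi_real (ι := Fin n); simpa using this
  have happ : ∀ s, ν s = μH[(n:ℝ)] (simpChart n '' s) := fun s => (simpChart_emb n).comap_apply _ s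
  have hle : ∀ s, volume s ≤ ν s := fun s => by
    have := (simpChart_anti n).le_hausdorffMeasure_image (d := n) (by positivity) s
    rw [happ, ← hvol]; simpa using this
  have : IsFiniteMeasureOnCompacts ν := ⟨fun C hC => by
    rw [happ]
    refine lt_of_le_of_lt ((simpChart_lip n).hausdorffMeasure_image_le (d := n) (by positivity) C) ?_
    rw [hvol]
    refine ENNReal.mul_lt_top ?_ hC.measure_lt_top
    exact ENNReal.rpow_lt_top_of_nonneg (by positivity) (by simp)⟩
  have : ν.IsAddLeftInvariant := ⟨fun v => by
    ext s hs
    rw [Measure.map_apply (by fun_prop) hs, happ, happ]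
    have himg : simpChart n '' ((fun x => v + x) ⁻¹' s) =
      (IsometryEquiv.addLeft (-(Fin.cons (-∑ i, v i) v : Fin (n+1) → ℝ))) '' (simpChart n '' s) := by
      have key : ∀ x, simpChart n (v + x) = (Fin.cons (-∑ i, v i) v : Fin (n+1) → ℝ) + simpChart n x := by
        intro x; funext i
        refine Fin.cases ?_ (fun j => ?_) i
        · simp [simpChart, Finset.sum_add_distrib]; ring
        · simp [simpChart]
      ext y
      constructor
      · rintro ⟨x, hx, rfl⟩
        refine ⟨_, ⟨v + x, hx, rfl⟩, ?_⟩
        rw [key]; simp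
      · rintro ⟨_, ⟨x, hx, rfl⟩, rfl⟩
        refine ⟨-v + x, by simpa using hx, ?_⟩
        have := key (-v + x)
        rw [add_neg_cancel_left] at this
        rw [this]; simp
    rw [himg, IsometryEquiv.hausdorffMeasure_image]⟩
  refine ⟨_, ?_, Measure.isAddLeftInvariant_eq_smul ν volume⟩
  intro h0
  have h1 := Measure.isAddLeftInvariant_eq_smul ν volume
  rw [h0, zero_smul] at h1
  have h2 := hle Set.univ
  rw [h1] at h2
  have h3 : (volume : Measure (Fin n → ℝ)) Set.univ = 0 := le_antisymm h2 (zero_le)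
  exact (Measure.measure_univ_ne_zero.2 (NeZero.ne (volume : Measure (Fin n → ℝ)))) h3

noncomputable def simpDom (n : ℕ) : Set (Fin n → ℝ) := simpChart n ⁻¹' stdSimplex ℝ (Fin (n+1))

theorem simpDom_meas (n : ℕ) : MeasurableSet (simpDom n) :=
  (isClosed_stdSimplex ℝ _).measurableSet.preimage (simpChart_cont n).measurable

theorem uniformSimplex_eq (n : ℕ) : uniformSimplex (n+1) =
    (volume (simpDom n))⁻¹ • ((volume.restrict (simpDom n)).map (simpChart n)) := by
  obtain ⟨c, hc, h⟩ := aux_hausdorff n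
  have hcast : ((n+1 : ℕ) : ℝ) - 1 = n := by push_cast; ring
  have hS : MeasurableSet (stdSimplex ℝ (Fin (n+1))) := (isClosed_stdSimplex ℝ _).measurableSet
  have hr : (μH[(n:ℝ)] : Measure (Fin (n+1) → ℝ)).restrict (stdSimplex ℝ (Fin (n+1))) =
      c • ((volume.restrict (simpDom n)).map (simpChart n)) := by
    have h1 := (simpChart_emb n).map_comap (μH[(n:ℝ)] : Measure (Fin (n+1) → ℝ))
    rw [h] at h1
    have h2 := congrArg (fun m => m.restrict (stdSimplex ℝ (Fin (n+1)))) h1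
    rw [Measure.restrict_restrict hS, Set.inter_eq_self_of_subset_left (simpChart_range n),
      (simpChart_emb n).restrict_map] at h2
    rw [← h2, Measure.restrict_smul, Measure.map_smul]
    rfl
  have hm : (μH[(n:ℝ)] : Measure (Fin (n+1) → ℝ)) (stdSimplex ℝ (Fin (n+1))) = c * volume (simpDom n) := by
    have := congrArg (fun m => m Set.univ) hr
    simp only [Measure.restrict_apply_univ] at this
    rw [this, Measure.smul_apply, Measure.map_apply (simpChart_emb n).measurable MeasurableSet.univ]
    simp [ENNReal.smul_def]
  unfold uniformSimplex
  rw [hcast, hr, hm]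
  ext s hs
  simp only [Measure.smul_apply, ENNReal.smul_def, smul_eq_mul]
  rw [ENNReal.mul_inv (by simp [hc]) (by simp), ← mul_assoc]
  congr 1
  rw [mul_right_comm, ENNReal.inv_mul_cancel (by simpa using hc) (by simp), one_mul]

end PartSimplex

section PartPolar
open ProbabilityTheory

theorem aux_scale (n : ℕ) (r : ℝ) (hr : 0 < r) (F : (Fin n → ℝ) → ENNReal) (hF : Measurable F) :
    ∫⁻ t, F t = ENNReal.ofReal (r ^ n) * ∫⁻ t, F (r • t) := by
  have h := Measure.map_addHaar_smul (volume : Measure (Fin n → ℝ)) hr.ne'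
  have h2 : ∫⁻ t, F (r • t) = ∫⁻ t, F t ∂(Measure.map (r • ·) (volume : Measure (Fin n → ℝ))) :=
    (lintegral_map hF (measurable_const_smul r)).symm
  rw [h2, h, lintegral_smul_measure, smul_eq_mul, ← mul_assoc, ← ENNReal.ofReal_mul (by positivity)]
  simp only [Module.finrank_fintype_fun_eq_card, Fintype.card_fin]
  rw [abs_of_pos (by positivity), mul_inv_cancel₀ (by positivity)]
  simp

theorem aux_slice (n : ℕ) (F : (Fin (n+1) → ℝ) → ENNReal) (hF : Measurable F) :
    ∫⁻ x, F x = ∫⁻ r : ℝ, ∫⁻ t : Fin n → ℝ, F (Fin.cons (r - ∑ i, t i) t) := by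
  have h := (volume_preserving_piFinSuccAbove (fun _ : Fin (n+1) => ℝ) 0).symm
  have hm : Measurable fun p : ℝ × (Fin n → ℝ) => F (Fin.cons p.1 p.2) := by
    refine hF.comp ?_
    refine measurable_pi_lambda _ fun i => ?_
    refine Fin.cases ?_ (fun j => ?_) i
    · simp only [Fin.cons_zero]; fun_prop
    · simp only [Fin.cons_succ]; fun_prop
  have e1 : ∫⁻ x, F x = ∫⁻ p : ℝ × (Fin n → ℝ), F (Fin.cons p.1 p.2) := by
    refine (h.lintegral_comp_emb (MeasurableEquiv.measurableEmbedding _) F).symm.trans ?_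
    refine lintegral_congr fun p => ?_
    congr 1
    change Fin.insertNth (α := fun _ => ℝ) 0 p.1 p.2 = _
    rw [Fin.insertNth_zero]
    rfl
  rw [e1]
  refine (lintegral_prod_symm _ hm.aemeasurable).trans ?_
  have e2 : ∀ t : Fin n → ℝ, ∫⁻ r : ℝ, F (Fin.cons r t) = ∫⁻ r : ℝ, F (Fin.cons (r - ∑ i, t i) t) :=
    fun t => (lintegral_sub_right_eq_self (fun r => F (Fin.cons r t)) (∑ i, t i)).symm
  simp only [e2]
  refine lintegral_lintegral_swap ?_
  refine Measurable.aemeasurable ?_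
  exact hm.comp (by fun_prop : Measurable fun p : (Fin n → ℝ) × ℝ => (p.2 - ∑ i, p.1 i, p.1))

theorem aux_polar (n : ℕ) (g : (Fin (n+1) → ℝ) → ENNReal) (hg : Measurable g) :
    ∫⁻ x, g x ∂(Measure.pi fun _ : Fin (n+1) => expMeasure 1) =
      ∫⁻ r : ℝ in Set.Ioi 0, ENNReal.ofReal (r ^ n * Real.exp (-r)) *
        ∫⁻ t in simpDom n, g (r • simpChart n t) := by
  have : SigmaFinite (volume.withDensity (gammaPDF 1 1)) := by
    have := isProbabilityMeasure_gammaMeasure (a := 1) (r := 1) one_pos one_pos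
    change SigmaFinite (gammaMeasure 1 1)
    infer_instance
  have hd : Measurable (gammaPDF 1 1) := (measurable_gammaPDFReal 1 1).ennreal_ofReal
  have hdd : Measurable fun x : Fin (n+1) → ℝ => ∏ i, gammaPDF 1 1 (x i) :=
    Finset.measurable_prod _ fun i _ => hd.comp (measurable_pi_apply i)
  have e0 : (Measure.pi fun _ : Fin (n+1) => expMeasure 1) =
      (volume : Measure (Fin (n+1) → ℝ)).withDensity (fun x => ∏ i, gammaPDF 1 1 (x i)) :=
    aux_pi_withDensity (n+1) _ hd
  rw [e0, lintegral_withDensity_eq_lintegral_mul _ hdd hg]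
  have hpos : ∀ x : Fin (n+1) → ℝ, (∀ i, 0 ≤ x i) → ∏ i, gammaPDF 1 1 (x i) =
      ENNReal.ofReal (Real.exp (-∑ i, x i)) := by
    intro x hx
    rw [← Finset.sum_neg_distrib, Real.exp_sum, ENNReal.ofReal_prod_of_nonneg (fun i _ => (Real.exp_pos _).le)]
    refine Finset.prod_congr rfl fun i _ => ?_
    rw [gammaPDF_of_nonneg (hx i)]
    simp
  have hneg : ∀ x : Fin (n+1) → ℝ, (¬ ∀ i, 0 ≤ x i) → ∏ i, gammaPDF 1 1 (x i) = 0 := by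
    intro x hx
    push Not at hx
    obtain ⟨i, hi⟩ := hx
    exact Finset.prod_eq_zero (Finset.mem_univ i) (gammaPDF_of_neg hi)
  have hFm : Measurable (fun x : Fin (n+1) → ℝ => (∏ i, gammaPDF 1 1 (x i)) * g x) := hdd.mul hg
  refine (aux_slice n (fun x => (∏ i, gammaPDF 1 1 (x i)) * g x) hFm).trans ?_
  rw [← lintegral_indicator measurableSet_Ioi]
  have hsum : ∀ (r : ℝ) (t : Fin n → ℝ), ∑ i, (Fin.cons (r - ∑ i, t i) t : Fin (n+1) → ℝ) i = r := by
    intro r t; rw [Fin.sum_univ_succ]; simp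
  refine lintegral_congr_ae ?_
  have h0 : ∀ᵐ r : ℝ, r ≠ 0 := by simp [ae_iff]
  filter_upwards [h0] with r hr0
  rcases lt_or_gt_of_ne hr0 with hr | hr
  · rw [Set.indicator_of_notMem (by simp [hr.le])]
    rw [lintegral_eq_zero_iff']
    · refine Filter.Eventually.of_forall fun t => ?_
      simp only [Pi.zero_apply]
      rw [hneg, zero_mul]
      intro hx
      have := hsum r t
      have h2 := Finset.sum_nonneg (s := Finset.univ) (fun i _ => hx i)
      linarith
    · refine (hFm.comp ?_).aemeasurable
      refine measurable_pi_lambda _ fun i => ?_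
      refine Fin.cases ?_ (fun j => ?_) i
      · simp only [Fin.cons_zero]; fun_prop
      · simp only [Fin.cons_succ]; fun_prop
  · rw [Set.indicator_of_mem (by exact hr)]
    rw [aux_scale n r hr]
    · have hc : ∀ t : Fin n → ℝ, (Fin.cons (r - ∑ i, (r • t) i) (r • t) : Fin (n+1) → ℝ) = r • simpChart n t := by
        intro t; funext i
        refine Fin.cases ?_ (fun j => ?_) i
        · simp [simpChart, ← Finset.mul_sum]; ring
        · simp [simpChart]
      simp only [hc]
      rw [ENNReal.ofReal_mul (by positivity), mul_assoc]
      congr 1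
      rw [← lintegral_indicator (simpDom_meas n), ← lintegral_const_mul']
      · refine lintegral_congr fun t => ?_
        have hs : ∑ i, simpChart n t i = 1 := hsum 1 t
        by_cases ht : t ∈ simpDom n
        · rw [Set.indicator_of_mem ht, hpos]
          · congr 3
            simp [← Finset.mul_sum, hs]
          · intro i
            exact mul_nonneg hr.le (ht.1 i)
        · rw [Set.indicator_of_notMem ht, hneg]
          · simp
          · intro h
            apply ht
            refine ⟨fun i => ?_, hs⟩
            have := h i
            simp only [Pi.smul_apply, smul_eq_mul] at this
            exact nonneg_of_mul_nonneg_right this hr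
      · simp
    · refine (hFm.comp ?_)
      refine measurable_pi_lambda _ fun i => ?_
      refine Fin.cases ?_ (fun j => ?_) i
      · simp only [Fin.cons_zero]; fun_prop
      · simp only [Fin.cons_succ]; fun_prop


theorem aux_gamma_lintegral (n : ℕ) (H : ℝ → ENNReal) (hH : Measurable H) :
    ∫⁻ r, H r ∂(gammaMeasure (n+1) 1) = (ENNReal.ofReal (Real.Gamma (n+1)))⁻¹ *
      ∫⁻ r : ℝ in Set.Ioi 0, ENNReal.ofReal (r ^ n * Real.exp (-r)) * H r := by
  have hG : 0 < Real.Gamma (n+1) := Real.Gamma_pos_of_pos (by positivity)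
  rw [gammaMeasure, lintegral_withDensity_eq_lintegral_mul _
    (show Measurable (gammaPDF (n+1) 1) from (measurable_gammaPDFReal _ _).ennreal_ofReal) hH,
    ← lintegral_const_mul' _ _ (by simp [hG]), ← lintegral_indicator measurableSet_Ioi]
  refine lintegral_congr_ae ?_
  have h0 : ∀ᵐ r : ℝ, r ≠ 0 := by simp [ae_iff]
  filter_upwards [h0] with r hr0
  rcases lt_or_gt_of_ne hr0 with hr | hr
  · rw [Set.indicator_of_notMem (by simp [hr.le])]
    simp [gammaPDF_of_neg hr]
  · rw [Set.indicator_of_mem (by exact hr), Pi.mul_apply, gammaPDF_of_nonneg hr.le, ← mul_assoc,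
      ← ENNReal.ofReal_inv_of_pos hG, ← ENNReal.ofReal_mul (by positivity)]
    congr 2
    simp
    ring

theorem simpDom_vol (n : ℕ) : (volume (simpDom n))⁻¹ = ENNReal.ofReal (Real.Gamma (n+1)) := by
  have hG : 0 < Real.Gamma (n+1) := Real.Gamma_pos_of_pos (by positivity)
  have := isProbabilityMeasure_expMeasure (r := 1) one_pos
  have := isProbabilityMeasure_gammaMeasure (a := n+1) (r := 1) (by positivity) one_pos
  have h1 := aux_polar n (fun _ => 1) measurable_const
  have h2 := aux_gamma_lintegral n (fun _ => 1) measurable_const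
  simp only [lintegral_const, measure_univ, mul_one, one_mul, Measure.restrict_apply_univ] at h1 h2
  rw [lintegral_mul_const _ (by fun_prop)] at h1
  have h3 : ∫⁻ r : ℝ in Set.Ioi 0, ENNReal.ofReal (r ^ n * Real.exp (-r)) = ENNReal.ofReal (Real.Gamma (n+1)) := by
    have := congrArg (fun z => ENNReal.ofReal (Real.Gamma (n+1)) * z) h2
    simp only [mul_one] at this
    rw [this, ← mul_assoc, ENNReal.mul_inv_cancel (by simpa using hG) (by simp), one_mul]
  rw [h3] at h1
  exact (ENNReal.eq_inv_of_mul_eq_one_left h1.symm).symm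

theorem expPi_lintegral (n : ℕ) (g : (Fin (n+1) → ℝ) → ENNReal) (hg : Measurable g) :
    ∫⁻ x, g x ∂(Measure.pi fun _ : Fin (n+1) => expMeasure 1) =
      ∫⁻ r, ∫⁻ μ, g (r • μ) ∂(uniformSimplex (n+1)) ∂(gammaMeasure (n+1) 1) := by
  have hG : 0 < Real.Gamma (n+1) := Real.Gamma_pos_of_pos (by positivity)
  have hm : Measurable fun p : ℝ × (Fin n → ℝ) => g (p.1 • simpChart n p.2) := by
    have := (simpChart_cont n).measurable
    fun_prop
  have e : ∀ r : ℝ, ∫⁻ μ, g (r • μ) ∂(uniformSimplex (n+1)) =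
      ENNReal.ofReal (Real.Gamma (n+1)) * ∫⁻ t in simpDom n, g (r • simpChart n t) := by
    intro r
    rw [uniformSimplex_eq, simpDom_vol, lintegral_smul_measure, smul_eq_mul,
      lintegral_map (by fun_prop) (simpChart_emb n).measurable]
  simp only [e]
  have hm2 : Measurable fun r : ℝ => ∫⁻ t in simpDom n, g (r • simpChart n t) :=
    hm.lintegral_prod_right'
  rw [aux_polar n g hg, aux_gamma_lintegral n _ (hm2.const_mul _), ← lintegral_const_mul' _ _ (by simp [hG])]
  refine lintegral_congr fun r => ?_
  rw [mul_left_comm]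
  congr 1
  rw [← mul_assoc, ENNReal.inv_mul_cancel (by simpa using hG) (by simp), one_mul]

theorem uniformSimplex_prob (n : ℕ) : IsProbabilityMeasure (uniformSimplex (n+1)) := by
  have hG : 0 < Real.Gamma (n+1) := Real.Gamma_pos_of_pos (by positivity)
  constructor
  rw [uniformSimplex_eq, Measure.smul_apply, Measure.map_apply (simpChart_emb n).measurable MeasurableSet.univ]
  simp only [Set.preimage_univ, Measure.restrict_apply_univ, smul_eq_mul]
  refine ENNReal.inv_mul_cancel ?_ ?_
  · rw [← ENNReal.inv_ne_top, simpDom_vol]; simp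
  · rw [← ENNReal.inv_ne_zero, simpDom_vol]; simpa using hG

theorem uniformSimplex_ae (N : ℕ) : ∀ᵐ μ ∂(uniformSimplex N), μ ∈ stdSimplex ℝ (Fin N) := by
  unfold uniformSimplex
  refine Measure.ae_smul_measure ?_ _
  exact ae_restrict_mem (isClosed_stdSimplex ℝ _).measurableSet

theorem expPi_eq (n : ℕ) : (Measure.pi fun _ : Fin (n+1) => expMeasure 1) =
    ((gammaMeasure (n+1) 1).prod (uniformSimplex (n+1))).map (fun p => p.1 • p.2) := by
  have := uniformSimplex_prob n
  ext s hs
  rw [← lintegral_indicator_one hs, expPi_lintegral n _ (measurable_one.indicator hs),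
    ← lintegral_indicator_one hs, lintegral_map (measurable_one.indicator hs) (by fun_prop)]
  refine (lintegral_prod (μ := gammaMeasure (n+1) 1) (ν := uniformSimplex (n+1))
    (fun p : ℝ × (Fin (n+1) → ℝ) => s.indicator 1 (p.1 • p.2)) (Measurable.aemeasurable ?_)).symm
  exact (measurable_one.indicator hs).comp (by fun_prop : Measurable fun p : ℝ × (Fin (n+1) → ℝ) => p.1 • p.2)

/-- homogeneous functions -/
theorem expPi_hom (n p : ℕ) (h : (Fin (n+1) → ℝ) → ℝ) (hm : Measurable h)
    (hh : ∀ r : ℝ, 0 ≤ r → ∀ μ, h (r • μ) = r ^ p * h μ) :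
    ∫ x, h x ∂(Measure.pi fun _ : Fin (n+1) => expMeasure 1) =
      (∫ r, r ^ p ∂(gammaMeasure (n+1) 1)) * ∫ μ, h μ ∂(uniformSimplex (n+1)) := by
  have := uniformSimplex_prob n
  have := isProbabilityMeasure_gammaMeasure (a := n+1) (r := 1) (by positivity) one_pos
  rw [expPi_eq, integral_map (by fun_prop) hm.aestronglyMeasurable, ← integral_prod_mul]
  refine integral_congr_ae ?_
  have hr : ∀ᵐ r ∂(gammaMeasure (n+1) 1), 0 ≤ r := by
    rw [ae_iff, gammaMeasure, withDensity_apply _ (by measurability)]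
    simp only [not_le]
    exact lintegral_gammaPDF_of_nonpos le_rfl
  have h2 : ∀ᵐ q ∂((gammaMeasure (n+1) 1).prod (uniformSimplex (n+1))), 0 ≤ q.1 :=
    Measure.quasiMeasurePreserving_fst.ae hr
  filter_upwards [h2] with q hq
  exact hh _ hq _

theorem gamma_moment (n p : ℕ) : ∫ r, r ^ p ∂(gammaMeasure (n+1) 1) =
    Real.Gamma (n+1+p) / Real.Gamma (n+1) := by
  have hG : 0 < Real.Gamma (n+1) := Real.Gamma_pos_of_pos (by positivity)
  rw [gammaMeasure, integral_withDensity_eq_integral_toReal_smul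
    (show Measurable (gammaPDF (n+1) 1) from (measurable_gammaPDFReal _ _).ennreal_ofReal) (by simp [gammaPDF])]
  rw [Real.Gamma_eq_integral (by positivity), ← integral_div, ← integral_indicator measurableSet_Ioi]
  refine integral_congr_ae ?_
  have h0 : ∀ᵐ r : ℝ, r ≠ 0 := by simp [ae_iff]
  filter_upwards [h0] with r hr0
  rcases lt_or_gt_of_ne hr0 with hr | hr
  · rw [Set.indicator_of_notMem (by simp [hr.le])]
    simp [gammaPDF_of_neg hr]
  · rw [Set.indicator_of_mem (by exact hr), gammaPDF_of_nonneg hr.le, ENNReal.toReal_ofReal (by positivity)]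
    have e1 : r ^ ((n:ℝ) + 1 + p - 1) = r ^ n * r ^ p := by
      rw [← pow_add, ← Real.rpow_natCast]; congr 1; push_cast; ring
    rw [e1]
    simp
    ring

end PartPolar

section PartQuad
open ProbabilityTheory

theorem pi_integral_zero (n : ℕ) (P : Measure ℝ) [IsProbabilityMeasure P] (i : Fin (n+1))
    (u : ℝ → ℝ) (hu : ∫ t, u t ∂P = 0) (w : (Fin (n+1) → ℝ) → ℝ)
    (hw : ∀ x t, w (Function.update x i t) = w x) :
    ∫ x, u (x i) * w x ∂(Measure.pi fun _ : Fin (n+1) => P) = 0 := by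
  have h := measurePreserving_piFinSuccAbove (fun _ : Fin (n+1) => P) i
  have e : (fun x : Fin (n+1) → ℝ => u (x i) * w x) =
      fun x => (fun p : ℝ × (Fin n → ℝ) => u p.1 * w (i.insertNth 0 p.2))
        (MeasurableEquiv.piFinSuccAbove (fun _ => ℝ) i x) := by
    funext x
    have h2 : w (i.insertNth 0 (i.removeNth x)) = w x := by
      rw [Fin.insertNth_removeNth, hw]
    simp only [MeasurableEquiv.piFinSuccAbove_apply]
    rw [← h2]
    rfl
  rw [e]
  refine (h.integral_comp (MeasurableEquiv.measurableEmbedding _)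
    (fun p : ℝ × (Fin n → ℝ) => u p.1 * w (i.insertNth 0 p.2))).trans ?_
  refine (integral_prod_mul (μ := P) (ν := Measure.pi fun _ : Fin n => P) u (fun y => w (i.insertNth 0 y))).trans ?_
  rw [hu, zero_mul]

variable (n : ℕ) (P : Measure ℝ) [IsProbabilityMeasure P] (ξ : ℝ → ℝ)

/-- centred products -/
noncomputable def psiF {n : ℕ} (ξ : ℝ → ℝ) (v : ℝ) (p : Fin (n+1) × Fin (n+1)) (x : Fin (n+1) → ℝ) : ℝ :=
  ξ (x p.1) * ξ (x p.2) - if p.1 = p.2 then v else 0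

theorem psiF_swap {n : ℕ} (ξ : ℝ → ℝ) (v : ℝ) (p : Fin (n+1) × Fin (n+1)) (x : Fin (n+1) → ℝ) :
    psiF ξ v p.swap x = psiF ξ v p x := by
  unfold psiF
  simp only [Prod.fst_swap, Prod.snd_swap, eq_comm (a := p.2), mul_comm (ξ (x p.2))]

theorem pi_integrable (f : ℝ → ℝ) (hf : Integrable f P) (i : Fin (n+1)) :
    Integrable (fun x : Fin (n+1) → ℝ => f (x i)) (Measure.pi fun _ : Fin (n+1) => P) :=
  (measurePreserving_eval (fun _ : Fin (n+1) => P) i).integrable_comp_of_integrable hf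

theorem pi_integral (f : ℝ → ℝ) (hf : AEStronglyMeasurable f P) (i : Fin (n+1)) :
    ∫ x : Fin (n+1) → ℝ, f (x i) ∂(Measure.pi fun _ : Fin (n+1) => P) = ∫ t, f t ∂P := by
  have h := measurePreserving_eval (fun _ : Fin (n+1) => P) i
  conv_rhs => rw [← h.map_eq]
  rw [integral_map h.measurable.aemeasurable (by rw [h.map_eq]; exact hf)]

theorem psiF_fst_zero (v : ℝ) (h0 : ∫ t, ξ t ∂P = 0) (hv : ∫ t, (ξ t)^2 ∂P = v)
    (h2 : Integrable (fun t => (ξ t)^2) P)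
    (p q : Fin (n+1) × Fin (n+1)) (h : p.1 ≠ q.1 ∧ p.1 ≠ q.2) :
    ∫ x, psiF ξ v p x * psiF ξ v q x ∂(Measure.pi fun _ : Fin (n+1) => P) = 0 := by
  obtain ⟨α, β⟩ := p
  obtain ⟨γ, δ⟩ := q
  obtain ⟨hγ, hδ⟩ := h
  simp only at hγ hδ
  by_cases hab : α = β
  · subst hab
    have := pi_integral_zero n P α (fun t => ξ t ^ 2 - v) (by
      rw [integral_sub h2 (integrable_const v), hv]; simp) (fun x => psiF ξ v (γ, δ) x) (by
        intro x t
        simp [psiF, Function.update_of_ne hγ.symm, Function.update_of_ne hδ.symm])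
    rw [← this]
    congr 1; funext x
    simp only [psiF, if_true]; ring
  · have := pi_integral_zero n P α ξ h0 (fun x => ξ (x β) * psiF ξ v (γ, δ) x) (by
        intro x t
        simp [psiF, Function.update_of_ne hγ.symm, Function.update_of_ne hδ.symm, Function.update_of_ne (Ne.symm hab)])
    rw [← this]
    congr 1; funext x
    simp [psiF, hab]; ring

theorem psiF_zero (v : ℝ) (h0 : ∫ t, ξ t ∂P = 0) (hv : ∫ t, (ξ t)^2 ∂P = v)
    (h2 : Integrable (fun t => (ξ t)^2) P)
    (p q : Fin (n+1) × Fin (n+1)) (h : q ≠ p ∧ q ≠ p.swap) :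
    ∫ x, psiF ξ v p x * psiF ξ v q x ∂(Measure.pi fun _ : Fin (n+1) => P) = 0 := by
  by_cases c1 : p.1 ≠ q.1 ∧ p.1 ≠ q.2
  · exact psiF_fst_zero n P ξ v h0 hv h2 p q c1
  by_cases c2 : p.2 ≠ q.1 ∧ p.2 ≠ q.2
  · have := psiF_fst_zero n P ξ v h0 hv h2 p.swap q c2
    simpa only [psiF_swap] using this
  by_cases c3 : q.1 ≠ p.1 ∧ q.1 ≠ p.2
  · have := psiF_fst_zero n P ξ v h0 hv h2 q p c3
    rw [← this]; congr 1; funext x; ring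
  by_cases c4 : q.2 ≠ p.1 ∧ q.2 ≠ p.2
  · have := psiF_fst_zero n P ξ v h0 hv h2 q.swap p c4
    simp only [psiF_swap] at this
    rw [← this]; congr 1; funext x; ring
  exfalso
  obtain ⟨α, β⟩ := p
  obtain ⟨γ, δ⟩ := q
  simp only [Prod.swap_prod_mk, ne_eq, Prod.mk.injEq] at *
  grind

theorem psiF_sq (v : ℝ) (hξ : Measurable ξ) (hv : ∫ t, (ξ t)^2 ∂P = v)
    (h2 : Integrable (fun t => (ξ t)^2) P) (h4 : Integrable (fun t => (ξ t)^4) P)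
    (p : Fin (n+1) × Fin (n+1)) :
    Integrable (fun x => (psiF ξ v p x)^2) (Measure.pi fun _ : Fin (n+1) => P) ∧
    ∫ x, (psiF ξ v p x)^2 ∂(Measure.pi fun _ : Fin (n+1) => P) ≤ 2 * ∫ t, (ξ t)^4 ∂P + 2 * v^2 := by
  have hi := fun i => pi_integrable n P _ h4 i
  have he := fun i => pi_integral n P _ h4.1 i
  have hm : Measurable (psiF ξ v p) := by unfold psiF; fun_prop
  have hb : ∀ x, (psiF ξ v p x)^2 ≤ (ξ (x p.1))^4 + (ξ (x p.2))^4 + 2 * v^2 := by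
    intro x
    unfold psiF
    set a := ξ (x p.1); set b := ξ (x p.2)
    have : ∀ w : ℝ, w = v ∨ w = 0 → (a * b - w)^2 ≤ a^4+b^4+2*v^2 := by
      intro w hw
      have : w^2 ≤ v^2 := by rcases hw with h | h <;> rw [h]; nlinarith [sq_nonneg v]
      nlinarith [sq_nonneg (a*b+w), sq_nonneg (a^2-b^2)]
    split_ifs
    · exact this _ (Or.inl rfl)
    · exact this _ (Or.inr rfl)
  have hI : Integrable (fun x : Fin (n+1) → ℝ => (ξ (x p.1))^4 + (ξ (x p.2))^4 + 2 * v^2)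
      (Measure.pi fun _ : Fin (n+1) => P) := ((hi _).add (hi _)).add (integrable_const _)
  refine ⟨hI.mono' (by fun_prop) (Filter.Eventually.of_forall fun x => ?_), ?_⟩
  · rw [Real.norm_of_nonneg (sq_nonneg _)]; exact hb x
  · refine (integral_mono_of_nonneg (Filter.Eventually.of_forall fun x => sq_nonneg _) hI
      (Filter.Eventually.of_forall hb)).trans ?_
    have e1 : ∫ x : Fin (n+1) → ℝ, ((ξ (x p.1))^4 + (ξ (x p.2))^4) + 2 * v^2 ∂(Measure.pi fun _ : Fin (n+1) => P)
      = (∫ x : Fin (n+1) → ℝ, ((ξ (x p.1))^4 + (ξ (x p.2))^4) ∂(Measure.pi fun _ : Fin (n+1) => P)) +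
        ∫ _x : Fin (n+1) → ℝ, 2 * v^2 ∂(Measure.pi fun _ : Fin (n+1) => P) :=
      integral_add ((hi _).add (hi _)) (integrable_const _)
    rw [e1, integral_add (hi _) (hi _), he, he]
    simp; linarith

theorem quad_var (v : ℝ) (hξ : Measurable ξ) (h0 : ∫ t, ξ t ∂P = 0) (hv : ∫ t, (ξ t)^2 ∂P = v)
    (h2 : Integrable (fun t => (ξ t)^2) P) (h4 : Integrable (fun t => (ξ t)^4) P)
    (c : Fin (n+1) × Fin (n+1) → ℝ) :
    Integrable (fun x => (∑ p, c p * psiF ξ v p x)^2) (Measure.pi fun _ : Fin (n+1) => P) ∧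
    ∫ x, (∑ p, c p * psiF ξ v p x)^2 ∂(Measure.pi fun _ : Fin (n+1) => P) ≤
      2 * (2 * ∫ t, (ξ t)^4 ∂P + 2 * v^2) * ∑ p, c p ^ 2 := by
  set C := 2 * ∫ t, (ξ t)^4 ∂P + 2 * v^2 with hC
  have hsq := psiF_sq n P ξ v hξ hv h2 h4
  have hm : ∀ p : Fin (n+1) × Fin (n+1), Measurable (psiF ξ v p) := by
    intro p; unfold psiF; fun_prop
  have hprod : ∀ p q : Fin (n+1) × Fin (n+1), Integrable (fun x => psiF ξ v p x * psiF ξ v q x)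
      (Measure.pi fun _ : Fin (n+1) => P) := by
    intro p q
    refine (((hsq p).1.add (hsq q).1)).mono' (by fun_prop) (Filter.Eventually.of_forall fun x => ?_)
    simp only [Pi.add_apply, Real.norm_eq_abs, abs_le]
    constructor <;> nlinarith [sq_nonneg (psiF ξ v p x + psiF ξ v q x), sq_nonneg (psiF ξ v p x - psiF ξ v q x), sq_nonneg (psiF ξ v p x), sq_nonneg (psiF ξ v q x)]
  have hbd : ∀ p q : Fin (n+1) × Fin (n+1), |∫ x, psiF ξ v p x * psiF ξ v q x ∂(Measure.pi fun _ : Fin (n+1) => P)| ≤ C := by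
    intro p q
    refine abs_integral_le_integral_abs.trans ?_
    have : ∫ x, |psiF ξ v p x * psiF ξ v q x| ∂(Measure.pi fun _ : Fin (n+1) => P) ≤
        ∫ x, ((psiF ξ v p x)^2 + (psiF ξ v q x)^2) / 2 ∂(Measure.pi fun _ : Fin (n+1) => P) := by
      refine integral_mono (hprod p q).abs (((hsq p).1.add (hsq q).1).div_const 2) fun x => ?_
      simp only [abs_le]
      constructor <;> nlinarith [sq_nonneg (psiF ξ v p x + psiF ξ v q x), sq_nonneg (psiF ξ v p x - psiF ξ v q x)]
    refine this.trans ?_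
    rw [integral_div, integral_add (hsq p).1 (hsq q).1]
    linarith [(hsq p).2, (hsq q).2]
  have hexp : ∀ x : Fin (n+1) → ℝ, (∑ p, c p * psiF ξ v p x)^2 =
      ∑ p, ∑ q, c p * c q * (psiF ξ v p x * psiF ξ v q x) := by
    intro x
    rw [sq, Finset.sum_mul_sum]
    refine Finset.sum_congr rfl fun p _ => Finset.sum_congr rfl fun q _ => by ring
  simp only [hexp]
  have hI : ∀ p q : Fin (n+1) × Fin (n+1), Integrable (fun x => c p * c q * (psiF ξ v p x * psiF ξ v q x))
      (Measure.pi fun _ : Fin (n+1) => P) := fun p q => (hprod p q).const_mul _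
  refine ⟨integrable_finsetSum _ fun p _ => integrable_finsetSum _ fun q _ => hI p q, ?_⟩
  rw [integral_finsetSum _ fun p _ => integrable_finsetSum _ fun q _ => hI p q]
  have h1 : ∀ p, ∫ x, ∑ q, c p * c q * (psiF ξ v p x * psiF ξ v q x) ∂(Measure.pi fun _ : Fin (n+1) => P)
      ≤ C * (2 * c p ^ 2 + (c p ^ 2 + c p.swap ^ 2)) / 2 := by
    intro p
    rw [integral_finsetSum _ fun q _ => hI p q]
    have hC0 : 0 ≤ C := by
      have := hbd p p
      exact (abs_nonneg _).trans this
    calc _ ≤ ∑ q, ((if q = p then C * c p ^ 2 else 0) + if q = p.swap then C * (c p ^ 2 + c p.swap ^ 2) / 2 else 0) := by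
          refine Finset.sum_le_sum fun q _ => ?_
          rw [integral_const_mul]
          by_cases hq : q ≠ p ∧ q ≠ p.swap
          · rw [psiF_zero n P ξ v h0 hv h2 p q hq, mul_zero, if_neg hq.1, if_neg hq.2, add_zero]
          · have hle : c p * c q * ∫ x, psiF ξ v p x * psiF ξ v q x ∂(Measure.pi fun _ : Fin (n+1) => P) ≤
              C * (c p ^ 2 + c q ^ 2) / 2 := by
              have h5 := hbd p q
              set I := ∫ x, psiF ξ v p x * psiF ξ v q x ∂(Measure.pi fun _ : Fin (n+1) => P)
              calc c p * c q * I ≤ |c p * c q * I| := le_abs_self _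
                _ = |c p * c q| * |I| := abs_mul _ _
                _ ≤ ((c p ^ 2 + c q ^ 2) / 2) * C := by
                  refine mul_le_mul ?_ h5 (abs_nonneg _) (by positivity)
                  rw [abs_le]; constructor <;> nlinarith [sq_nonneg (c p + c q), sq_nonneg (c p - c q)]
                _ = _ := by ring
            by_cases h6 : q = p
            · subst h6
              rw [if_pos rfl]
              have : 0 ≤ (if q = q.swap then C * (c q ^ 2 + c q.swap ^ 2) / 2 else 0) := by
                split_ifs <;> positivity
              linarith
            · have h7 : q = p.swap := by by_contra h8; exact hq ⟨h6, h8⟩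
              subst h7
              rw [if_neg h6, if_pos rfl, zero_add]; exact hle
      _ = _ := by
          rw [Finset.sum_add_distrib, Finset.sum_ite_eq', Finset.sum_ite_eq']
          simp; ring
  refine (Finset.sum_le_sum fun p _ => h1 p).trans ?_
  have hsw : ∑ p : Fin (n+1) × Fin (n+1), c p.swap ^ 2 = ∑ p, c p ^ 2 :=
    Equiv.sum_comp (Equiv.prodComm _ _) (fun p => c p ^ 2)
  rw [← Finset.sum_div, ← Finset.mul_sum, Finset.sum_add_distrib, Finset.sum_add_distrib, ← Finset.mul_sum, hsw]
  apply le_of_eq; ring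

end PartQuad

section PartQuadSimplex
open ProbabilityTheory

theorem exp_moment (p : ℕ) : ∫ r, r ^ p ∂(expMeasure 1) = Real.Gamma (1 + p) := by
  have := gamma_moment 0 p
  simpa [expMeasure] using this

theorem exp_integrable (p : ℕ) : Integrable (fun r => r ^ p) (expMeasure 1) := by
  by_contra h
  have h1 := exp_moment p
  rw [integral_undef h] at h1
  have : 0 < Real.Gamma (1 + p) := Real.Gamma_pos_of_pos (by positivity)
  linarith

theorem exp_ae_nonneg : ∀ᵐ r ∂(expMeasure 1), 0 ≤ r := by
  rw [ae_iff, expMeasure, gammaMeasure, withDensity_apply _ (by measurability)]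
  simp only [not_le]
  exact lintegral_gammaPDF_of_nonpos le_rfl

theorem exp_sqrt : ∫ r, Real.sqrt r ∂(expMeasure 1) = Real.sqrt Real.pi / 2 := by
  have h32 : Real.Gamma (3/2) = Real.sqrt Real.pi / 2 := by
    have := Real.Gamma_add_one (s := 1/2) (by norm_num)
    rw [Real.Gamma_one_half_eq] at this
    rw [show (3/2 : ℝ) = 1/2 + 1 by norm_num, this]; ring
  rw [← h32]
  rw [expMeasure, gammaMeasure, integral_withDensity_eq_integral_toReal_smul
    (show Measurable (gammaPDF 1 1) from (measurable_gammaPDFReal _ _).ennreal_ofReal) (by simp [gammaPDF])]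
  rw [Real.Gamma_eq_integral (by positivity), ← integral_indicator measurableSet_Ioi]
  refine integral_congr_ae ?_
  have h0 : ∀ᵐ r : ℝ, r ≠ 0 := by simp [ae_iff]
  filter_upwards [h0] with r hr0
  rcases lt_or_gt_of_ne hr0 with hr | hr
  · rw [Set.indicator_of_notMem (by simp [hr.le])]
    simp [gammaPDF_of_neg hr]
  · rw [Set.indicator_of_mem (by exact hr), gammaPDF_of_nonneg hr.le, ENNReal.toReal_ofReal (by positivity)]
    rw [Real.sqrt_eq_rpow, show (3/2 - 1 : ℝ) = 1/2 by norm_num]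
    simp

noncomputable def xiF (t : ℝ) : ℝ := Real.sqrt t - Real.sqrt Real.pi / 2

theorem xiF_meas : Measurable xiF := by unfold xiF; fun_prop

theorem sqrt_integrable : Integrable (fun r => Real.sqrt r) (expMeasure 1) := by
  by_contra h
  have h1 := exp_sqrt
  rw [integral_undef h] at h1
  have : 0 < Real.sqrt Real.pi / 2 := by positivity
  linarith

theorem integral_lin3 {Ω : Type*} [MeasurableSpace Ω] {μ : Measure Ω} [IsProbabilityMeasure μ]
    {f g : Ω → ℝ} (hf : Integrable f μ) (hg : Integrable g μ) (c d : ℝ) :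
    ∫ x, f x + (c * g x + d) ∂μ = ∫ x, f x ∂μ + (c * ∫ x, g x ∂μ + d) := by
  have h1 : Integrable (fun x => c * g x) μ := hg.const_mul c
  have h2 : Integrable (fun x => c * g x + d) μ := h1.add (integrable_const d)
  have e1 : ∫ x, f x + (c * g x + d) ∂μ = ∫ x, f x ∂μ + ∫ x, (c * g x + d) ∂μ := integral_add hf h2
  have e2 : ∫ x, (c * g x + d) ∂μ = ∫ x, c * g x ∂μ + ∫ _, d ∂μ := integral_add h1 (integrable_const d)
  rw [e1, e2, integral_const_mul]; simp

theorem xiF_facts : ∫ t, xiF t ∂(expMeasure 1) = 0 ∧ ∫ t, (xiF t)^2 ∂(expMeasure 1) = 1 - Real.pi / 4 ∧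
    Integrable (fun t => (xiF t)^2) (expMeasure 1) ∧ Integrable (fun t => (xiF t)^4) (expMeasure 1) := by
  have := isProbabilityMeasure_expMeasure (r := 1) one_pos
  have i1 : Integrable (fun r : ℝ => r) (expMeasure 1) := by simpa using exp_integrable 1
  have hm1 : ∫ r, r ∂(expMeasure 1) = 1 := by
    have := exp_moment 1
    simp only [pow_one, Nat.cast_one] at this
    rw [this, show (1 + 1 : ℝ) = 2 by norm_num, Real.Gamma_two]
  have hsq : (fun t => (xiF t)^2) =ᵐ[expMeasure 1] fun t => t + ((- Real.sqrt Real.pi) * Real.sqrt t + Real.pi / 4) := by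
    filter_upwards [exp_ae_nonneg] with t ht
    unfold xiF
    nlinarith [Real.sq_sqrt ht, Real.sq_sqrt Real.pi_pos.le]
  have i2 : Integrable (fun t => t + ((- Real.sqrt Real.pi) * Real.sqrt t + Real.pi / 4)) (expMeasure 1) :=
    i1.add ((sqrt_integrable.const_mul _).add (integrable_const _))
  refine ⟨?_, ?_, ?_, ?_⟩
  · unfold xiF
    rw [integral_sub sqrt_integrable (integrable_const _), exp_sqrt]; simp
  · rw [integral_congr_ae hsq, integral_lin3 i1 sqrt_integrable, exp_sqrt, hm1]
    nlinarith [Real.sq_sqrt Real.pi_pos.le]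
  · exact i2.congr hsq.symm
  · have hI : Integrable (fun t : ℝ => 8 * t^2 + 8 * (Real.sqrt Real.pi / 2)^4) (expMeasure 1) :=
      ((exp_integrable 2).const_mul 8).add (integrable_const _)
    refine hI.mono' (by have := xiF_meas; fun_prop) ?_
    filter_upwards [exp_ae_nonneg] with t ht
    rw [Real.norm_of_nonneg (by positivity)]
    unfold xiF
    set b := Real.sqrt Real.pi / 2
    have h1 : (Real.sqrt t)^4 = t^2 := by
      rw [show (Real.sqrt t)^4 = ((Real.sqrt t)^2)^2 by ring, Real.sq_sqrt ht]
    rw [← h1]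
    set a := Real.sqrt t
    have h2 : (a-b)^2 ≤ 2*a^2+2*b^2 := by nlinarith [sq_nonneg (a+b)]
    have h3 : ((a-b)^2)^2 ≤ (2*a^2+2*b^2)^2 := by gcongr
    nlinarith [sq_nonneg (a^2-b^2)]

/-- quadratic form -/
noncomputable def qf {N : ℕ} (M : Matrix (Fin N) (Fin N) ℝ) (y : Fin N → ℝ) : ℝ :=
  ∑ p : Fin N × Fin N, M p.1 p.2 * (y p.1 * y p.2)

noncomputable def sqv {N : ℕ} (μ : Fin N → ℝ) : Fin N → ℝ := fun α => Real.sqrt (μ α)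

theorem qf_shift {N : ℕ} (M : Matrix (Fin N) (Fin N) ℝ) (h1 : ∀ i, ∑ j, M i j = 0)
    (h2 : ∀ j, ∑ i, M i j = 0) (y : Fin N → ℝ) (c : ℝ) : qf M y = qf M (fun i => y i - c) := by
  unfold qf
  have e : ∀ p : Fin N × Fin N, M p.1 p.2 * ((y p.1 - c) * (y p.2 - c)) =
    M p.1 p.2 * (y p.1 * y p.2) - c * y p.1 * M p.1 p.2 - c * y p.2 * M p.1 p.2 + c^2 * M p.1 p.2 := by
    intro p; ring
  simp only [e, Finset.sum_add_distrib, Finset.sum_sub_distrib]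
  have a1 : ∑ p : Fin N × Fin N, c * y p.1 * M p.1 p.2 = 0 := by
    rw [Fintype.sum_prod_type]; simp [← Finset.mul_sum, h1]
  have a2 : ∑ p : Fin N × Fin N, c * y p.2 * M p.1 p.2 = 0 := by
    rw [Fintype.sum_prod_type_right]; simp [← Finset.mul_sum, h2]
  have a3 : ∑ p : Fin N × Fin N, c^2 * M p.1 p.2 = 0 := by
    rw [Fintype.sum_prod_type]; simp [← Finset.mul_sum, h1]
  rw [a1, a2, a3]; ring

theorem simplex_quad : ∃ C : ℝ, 0 ≤ C ∧ ∀ (n : ℕ) (M : Matrix (Fin (n+1)) (Fin (n+1)) ℝ),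
    (∀ i, ∑ j, M i j = 0) → (∀ j, ∑ i, M i j = 0) →
    Integrable (fun μ => (qf M (sqv μ) - (1 - Real.pi/4) / (n+1) * M.trace)^2) (uniformSimplex (n+1)) ∧
    ∫ μ, (qf M (sqv μ) - (1 - Real.pi/4) / (n+1) * M.trace)^2 ∂(uniformSimplex (n+1)) ≤
      C * (∑ p : Fin (n+1) × Fin (n+1), M p.1 p.2 ^ 2) / (n+1)^2 := by
  obtain ⟨x0, x1, x2, x4⟩ := xiF_facts
  have hP := isProbabilityMeasure_expMeasure (r := 1) one_pos
  set v := 1 - Real.pi/4 with hv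
  refine ⟨2 * (2 * ∫ t, (xiF t)^4 ∂(expMeasure 1) + 2 * v^2), ?_, ?_⟩
  · have : 0 ≤ ∫ t, (xiF t)^4 ∂(expMeasure 1) := integral_nonneg fun t => by positivity
    positivity
  intro n M h1 h2
  have hU := uniformSimplex_prob n
  obtain ⟨q1, q2⟩ := quad_var n (expMeasure 1) xiF v xiF_meas x0 x1 x2 x4 (fun p => M p.1 p.2)
  set E := Measure.pi fun _ : Fin (n+1) => expMeasure 1 with hE
  set S := ∑ p : Fin (n+1) × Fin (n+1), M p.1 p.2 ^ 2 with hS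
  -- relation
  have hmeas : Measurable fun μ : Fin (n+1) → ℝ => qf M (sqv μ) := by unfold qf sqv; fun_prop
  have hrel : ∀ x : Fin (n+1) → ℝ, qf M (sqv x) = ∑ p, M p.1 p.2 * psiF xiF v p x + v * M.trace := by
    intro x
    rw [qf_shift M h1 h2 _ (Real.sqrt Real.pi / 2)]
    unfold psiF
    simp only [mul_sub, Finset.sum_sub_distrib]
    have : ∑ p : Fin (n+1) × Fin (n+1), M p.1 p.2 * (if p.1 = p.2 then v else 0) = v * M.trace := by
      rw [Fintype.sum_prod_type]
      simp [Matrix.trace, Finset.mul_sum, mul_comm]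
    rw [this]
    simp only [sub_add_cancel]
    rfl
  have hom1 : ∀ r : ℝ, 0 ≤ r → ∀ μ : Fin (n+1) → ℝ, qf M (sqv (r • μ)) = r * qf M (sqv μ) := by
    intro r hr μ
    unfold qf sqv
    rw [Finset.mul_sum]
    refine Finset.sum_congr rfl fun p _ => ?_
    simp only [Pi.smul_apply, smul_eq_mul, Real.sqrt_mul hr]
    have := Real.mul_self_sqrt hr
    linear_combination M p.1 p.2 * Real.sqrt (μ p.1) * Real.sqrt (μ p.2) * this
  have hG : 0 < Real.Gamma (n+1) := Real.Gamma_pos_of_pos (by positivity)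
  have g1 : Real.Gamma ((n:ℝ)+1+1) = (n+1) * Real.Gamma (n+1) := Real.Gamma_add_one (by positivity)
  have g2 : Real.Gamma ((n:ℝ)+1+2) = (n+2) * ((n+1) * Real.Gamma (n+1)) := by
    rw [← g1, show (n:ℝ)+1+2 = (n+1+1)+1 by ring, Real.Gamma_add_one (by positivity)]; ring
  have m1 := expPi_hom n 1 (fun μ => qf M (sqv μ)) hmeas (by simpa using hom1)
  have m2 := expPi_hom n 2 (fun μ => (qf M (sqv μ))^2) (by fun_prop) (by
    intro r hr μ; rw [hom1 r hr]; ring)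
  rw [gamma_moment] at m1 m2
  simp only [Nat.cast_one, Nat.cast_ofNat] at m1 m2
  rw [g1, mul_div_assoc, div_self hG.ne', mul_one] at m1
  rw [g2, mul_div_assoc, mul_div_assoc, div_self hG.ne', mul_one] at m2
  -- integrability of psi sum
  set W : (Fin (n+1) → ℝ) → ℝ := fun x => ∑ p, M p.1 p.2 * psiF xiF v p x with hW
  have hWm : Measurable W := by
    have := xiF_meas
    simp only [hW]; unfold psiF; fun_prop
  have hW1 : Integrable W E := by
    refine (q1.add (integrable_const 1)).mono' (by fun_prop) (Filter.Eventually.of_forall fun x => ?_)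
    simp only [Pi.add_apply, Real.norm_eq_abs, abs_le]
    change -(W x ^2 + 1) ≤ W x ∧ W x ≤ W x ^2 + 1
    constructor <;> nlinarith [sq_nonneg (W x + 1), sq_nonneg (W x - 1)]
  have hW0 : ∫ x, W x ∂E = 0 := by
    have hint : ∀ p : Fin (n+1) × Fin (n+1), Integrable (psiF xiF v p) E := by
      intro p
      refine ((psiF_sq n (expMeasure 1) xiF v xiF_meas x1 x2 x4 p).1.add (integrable_const 1)).mono' (by
        have := xiF_meas
        unfold psiF; fun_prop) (Filter.Eventually.of_forall fun x => ?_)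
      simp only [Pi.add_apply, Real.norm_eq_abs, abs_le]
      constructor <;> nlinarith [sq_nonneg (psiF xiF v p x + 1), sq_nonneg (psiF xiF v p x - 1)]
    rw [hW, integral_finsetSum _ fun p _ => (hint p).const_mul _]
    refine Finset.sum_eq_zero fun p _ => ?_
    rw [integral_const_mul]
    have : ∫ x, psiF xiF v p x ∂E = 0 := by
      by_cases hp : p.1 = p.2
      · have e := pi_integral n (expMeasure 1) (fun t => xiF t ^ 2) x2.1 p.1
        have hi := pi_integrable n (expMeasure 1) (fun t => xiF t ^ 2) x2 p.1
        have : ∀ x, psiF xiF v p x = xiF (x p.1) ^ 2 - v := by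
          intro x; unfold psiF; rw [if_pos hp, ← hp]; ring
        simp only [this]
        rw [integral_sub hi (integrable_const _), e, x1]; simp
      · have := pi_integral_zero n (expMeasure 1) p.1 xiF x0 (fun x => xiF (x p.2)) (by
          intro x t; simp [Function.update_of_ne (Ne.symm hp)])
        rw [← this]; congr 1; funext x; simp [psiF, hp]
    rw [this, mul_zero]
  have E1 : ∫ x, qf M (sqv x) ∂E = v * M.trace := by
    simp only [hrel]
    rw [integral_add hW1 (integrable_const _), hW0]; simp
  have E2 : ∫ x, (qf M (sqv x))^2 ∂E = ∫ x, W x ^ 2 ∂E + (v * M.trace)^2 := by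
    have : ∀ x, (qf M (sqv x))^2 = W x ^ 2 + (2 * (v * M.trace) * W x + (v * M.trace)^2) := by
      intro x; rw [hrel]; simp only [hW]; ring
    simp only [this]
    have q1' : Integrable (fun x => W x ^ 2) E := q1
    rw [integral_lin3 q1' hW1, hW0]; simp
  rw [E1] at m1
  rw [E2] at m2
  -- boundedness on simplex
  have hbd : ∀ᵐ μ ∂(uniformSimplex (n+1)), |qf M (sqv μ)| ≤ ∑ p : Fin (n+1) × Fin (n+1), |M p.1 p.2| := by
    filter_upwards [uniformSimplex_ae (n+1)] with μ hμ
    unfold qf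
    refine (Finset.abs_sum_le_sum_abs _ _).trans (Finset.sum_le_sum fun p _ => ?_)
    have hs : ∀ i, 0 ≤ sqv μ i ∧ sqv μ i ≤ 1 := fun i =>
      ⟨Real.sqrt_nonneg _, by
        unfold sqv
        rw [Real.sqrt_le_one]
        have := hμ.2
        rw [← this]
        exact Finset.single_le_sum (fun j _ => hμ.1 j) (Finset.mem_univ i)⟩
    rw [abs_mul, abs_of_nonneg (mul_nonneg (hs _).1 (hs _).1)]
    exact mul_le_of_le_one_right (abs_nonneg _) (mul_le_one₀ (hs _).2 (hs _).1 (hs _).2)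
  set B := ∑ p : Fin (n+1) × Fin (n+1), |M p.1 p.2|
  have I1 : Integrable (fun μ => qf M (sqv μ)) (uniformSimplex (n+1)) :=
    (integrable_const B).mono' hmeas.aestronglyMeasurable (by simpa using hbd)
  have I2 : Integrable (fun μ => qf M (sqv μ)^2) (uniformSimplex (n+1)) :=
    (integrable_const (B^2)).mono' (hmeas.pow_const 2).aestronglyMeasurable (by
      filter_upwards [hbd] with μ h
      rw [Real.norm_of_nonneg (sq_nonneg _), ← sq_abs]
      gcongr)
  have hexp : ∀ μ : Fin (n+1) → ℝ, (qf M (sqv μ) - v / (n+1) * M.trace)^2 =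
      qf M (sqv μ)^2 + ((-2 * (v / (n+1) * M.trace)) * qf M (sqv μ) + (v / (n+1) * M.trace)^2) := by
    intro μ; ring
  simp only [hexp]
  refine ⟨I2.add ((I1.const_mul _).add (integrable_const _)), ?_⟩
  rw [integral_lin3 I2 I1]
  set e1 := ∫ μ, qf M (sqv μ) ∂(uniformSimplex (n+1))
  set e2 := ∫ μ, qf M (sqv μ)^2 ∂(uniformSimplex (n+1))
  have he1 : e1 = v / (n+1) * M.trace := by
    field_simp; linarith
  rw [he1]
  set tr := v * M.trace with htr
  set D := ∫ x, W x ^ 2 ∂E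
  set CC := 2 * (2 * ∫ t, (xiF t)^4 ∂(expMeasure 1) + 2 * v^2)
  have q2' : D ≤ CC * S := q2
  have hn : (0:ℝ) < n + 1 := by positivity
  have he2 : e2 ≤ (CC * S + tr^2) / (n+1)^2 := by
    rw [le_div_iff₀ (by positivity)]
    have : 0 ≤ e2 := integral_nonneg fun μ => sq_nonneg _
    nlinarith [mul_nonneg hn.le this]
  have : v / (n+1) * M.trace = tr / (n+1) := by rw [htr]; ring
  rw [this]
  have h9 : (CC * S + tr^2) / (n+1)^2 = CC * S / (n+1)^2 + (tr/(n+1))^2 := by field_simp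
  rw [h9] at he2
  linarith [sq_nonneg (tr/(n+1))]

end PartQuadSimplex

section PartLinAlg
set_option linter.unusedSectionVars false
open Matrix

variable {ι κ : Type*} [Fintype ι] [DecidableEq ι] [Fintype κ] [DecidableEq κ]

noncomputable def rs (A : Matrix ι ι ℝ) (s : ℝ) : Matrix ι ι ℝ := (A + s • (1 : Matrix ι ι ℝ))⁻¹

theorem rs_posDef_add {A : Matrix ι ι ℝ} (hA : A.PosSemidef) {s : ℝ} (hs : 0 < s) :
    (A + s • (1 : Matrix ι ι ℝ)).PosDef :=
  (Matrix.PosDef.one.smul hs).posSemidef_add hA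

theorem rs_isUnit {A : Matrix ι ι ℝ} (hA : A.PosSemidef) {s : ℝ} (hs : 0 < s) :
    IsUnit (A + s • (1 : Matrix ι ι ℝ)).det :=
  (rs_posDef_add hA hs).det_pos.ne'.isUnit

theorem rs_psd {A : Matrix ι ι ℝ} (hA : A.PosSemidef) {s : ℝ} (hs : 0 < s) : (rs A s).PosSemidef :=
  (rs_posDef_add hA hs).posSemidef.inv

theorem rs_symm {A : Matrix ι ι ℝ} (hA : A.PosSemidef) {s : ℝ} (hs : 0 < s) : (rs A s)ᵀ = rs A s := by
  have := (rs_psd hA hs).isHermitian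
  rwa [Matrix.IsHermitian, Matrix.conjTranspose_eq_transpose_of_trivial] at this

theorem rs_mul {A : Matrix ι ι ℝ} (hA : A.PosSemidef) {s : ℝ} (hs : 0 < s) :
    (A + s • (1 : Matrix ι ι ℝ)) * rs A s = 1 := Matrix.mul_nonsing_inv _ (rs_isUnit hA hs)

theorem mul_rs {A : Matrix ι ι ℝ} (hA : A.PosSemidef) {s : ℝ} (hs : 0 < s) :
    rs A s * (A + s • (1 : Matrix ι ι ℝ)) = 1 := Matrix.nonsing_inv_mul _ (rs_isUnit hA hs)

theorem psd_dot {A : Matrix ι ι ℝ} (hA : A.PosSemidef) (v : ι → ℝ) : 0 ≤ v ⬝ᵥ (A *ᵥ v) := by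
  simpa using hA.dotProduct_mulVec_nonneg v

theorem dot_self_nn (v : ι → ℝ) : 0 ≤ v ⬝ᵥ v := by
  simp only [dotProduct]; exact Finset.sum_nonneg fun i _ => mul_self_nonneg _

theorem rs_eq {A : Matrix ι ι ℝ} (hA : A.PosSemidef) {s : ℝ} (hs : 0 < s) (w : ι → ℝ) :
    w = A *ᵥ (rs A s *ᵥ w) + s • (rs A s *ᵥ w) := by
  have h := congrArg (fun M => M *ᵥ w) (rs_mul hA hs)
  simp only [← Matrix.mulVec_mulVec, Matrix.add_mulVec, Matrix.smul_mulVec, Matrix.one_mulVec] at h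
  exact h.symm

theorem rs_bd1 {A : Matrix ι ι ℝ} (hA : A.PosSemidef) {s : ℝ} (hs : 0 < s) (w : ι → ℝ) :
    s * ((rs A s *ᵥ w) ⬝ᵥ (rs A s *ᵥ w)) ≤ w ⬝ᵥ (rs A s *ᵥ w) := by
  set z := rs A s *ᵥ w with hz
  have e : w = A *ᵥ z + s • z := rs_eq hA hs w
  have : w ⬝ᵥ z = z ⬝ᵥ (A *ᵥ z) + s * (z ⬝ᵥ z) := by
    conv_lhs => rw [e]
    rw [add_dotProduct, smul_dotProduct, smul_eq_mul, dotProduct_comm]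
  rw [this]; linarith [psd_dot hA z]

theorem rs_bd2 {A : Matrix ι ι ℝ} (hA : A.PosSemidef) {s : ℝ} (hs : 0 < s) (w : ι → ℝ) :
    s * (w ⬝ᵥ (rs A s *ᵥ w)) ≤ w ⬝ᵥ w := by
  set z := rs A s *ᵥ w with hz
  have e : w = A *ᵥ z + s • z := rs_eq hA hs w
  have e1 : w ⬝ᵥ z = z ⬝ᵥ (A *ᵥ z) + s * (z ⬝ᵥ z) := by
    conv_lhs => rw [e]
    rw [add_dotProduct, smul_dotProduct, smul_eq_mul, dotProduct_comm]
  have e2 : w ⬝ᵥ w = (A *ᵥ z) ⬝ᵥ (A *ᵥ z) + 2 * s * (z ⬝ᵥ (A *ᵥ z)) + s^2 * (z ⬝ᵥ z) := by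
    conv_lhs => rw [e]
    simp only [add_dotProduct, dotProduct_add, smul_dotProduct, dotProduct_smul, smul_eq_mul]
    rw [dotProduct_comm (A *ᵥ z) z]; ring
  rw [e1, e2]
  nlinarith [mul_nonneg hs.le (psd_dot hA z), dot_self_nn (A *ᵥ z)]

theorem rs_col (A : Matrix ι ι ℝ) (s : ℝ) (b : ι) : rs A s *ᵥ (Pi.single b 1) = fun a => rs A s a b := by
  ext a; simp

theorem rs_diag {A : Matrix ι ι ℝ} (hA : A.PosSemidef) {s : ℝ} (hs : 0 < s) (b : ι) :
    rs A s b b ≤ 1 / s := by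
  have h := rs_bd2 hA hs (Pi.single b 1)
  rw [rs_col] at h
  simp at h
  rw [le_div_iff₀ hs]; linarith

theorem rs_trace {A : Matrix ι ι ℝ} (hA : A.PosSemidef) {s : ℝ} (hs : 0 < s) :
    0 ≤ (rs A s).trace ∧ (rs A s).trace ≤ Fintype.card ι / s := by
  refine ⟨(rs_psd hA hs).trace_nonneg, ?_⟩
  refine (Finset.sum_le_sum fun b _ => rs_diag hA hs b).trans ?_
  simp [div_eq_mul_inv]

theorem rs_sq {A : Matrix ι ι ℝ} (hA : A.PosSemidef) {s : ℝ} (hs : 0 < s) :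
    ∑ p : ι × ι, rs A s p.1 p.2 ^ 2 ≤ Fintype.card ι / s^2 := by
  rw [Fintype.sum_prod_type_right]
  have h : ∀ b, ∑ a, rs A s a b ^ 2 ≤ 1 / s^2 := by
    intro b
    have h1 := rs_bd1 hA hs (Pi.single b 1)
    rw [rs_col] at h1
    have h2 := rs_diag hA hs b
    simp only [single_dotProduct, one_mul] at h1
    have : ∑ a, rs A s a b ^ 2 = (fun a => rs A s a b) ⬝ᵥ (fun a => rs A s a b) := by
      simp [dotProduct, sq]
    rw [this]
    rw [le_div_iff₀ (by positivity)]
    rw [le_div_iff₀ hs] at h2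
    nlinarith
  refine (Finset.sum_le_sum fun b _ => h b).trans ?_
  simp [div_eq_mul_inv]

theorem vv_psd (v : ι → ℝ) : (vecMulVec v v).PosSemidef := by
  have := Matrix.posSemidef_vecMulVec_self_star v
  simpa using this

theorem rs_rank1 {A : Matrix ι ι ℝ} (hA : A.PosSemidef) {s : ℝ} (hs : 0 < s) (v : ι → ℝ) :
    let q := v ⬝ᵥ (rs A s *ᵥ v)
    0 ≤ q ∧ v ⬝ᵥ (rs (A + vecMulVec v v) s *ᵥ v) = q / (1 + q) ∧
    0 ≤ (rs A s).trace - (rs (A + vecMulVec v v) s).trace ∧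
    (rs A s).trace - (rs (A + vecMulVec v v) s).trace ≤ 1 / s := by
  intro q
  have hA' := hA.add (vv_psd v)
  set R := rs A s with hR
  set R' := rs (A + vecMulVec v v) s with hR'
  have hq : 0 ≤ q := psd_dot (rs_psd hA hs) v
  have h1 : R *ᵥ v = (1 + q) • (R' *ᵥ v) := by
    have : R' *ᵥ ((A + vecMulVec v v + s • (1 : Matrix ι ι ℝ)) *ᵥ (R *ᵥ v)) = R *ᵥ v := by
      rw [Matrix.mulVec_mulVec, mul_rs hA' hs, Matrix.one_mulVec]
    rw [← this, ← Matrix.mulVec_smul]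
    congr 1
    rw [show A + vecMulVec v v + s • (1 : Matrix ι ι ℝ) = (A + s • 1) + vecMulVec v v by abel,
      Matrix.add_mulVec, Matrix.mulVec_mulVec, rs_mul hA hs, Matrix.one_mulVec, vecMulVec_mulVec]
    ext i; simp [q]; ring
  have h2 : R' *ᵥ v = (1 + q)⁻¹ • (R *ᵥ v) := by
    rw [h1, smul_smul, inv_mul_cancel₀ (by positivity), one_smul]
  have h3 : R - R' = vecMulVec (R' *ᵥ v) (R *ᵥ v) := by
    have e1 : R - R' = R' * (vecMulVec v v) * R := by
      have : vecMulVec v v = (A + vecMulVec v v + s • (1 : Matrix ι ι ℝ)) - (A + s • 1) := by abel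
      rw [this, Matrix.mul_sub, Matrix.sub_mul, mul_rs hA' hs, Matrix.mul_assoc, rs_mul hA hs]
      simp [R]
    rw [e1, mul_vecMulVec, vecMulVec_mul, ← Matrix.mulVec_transpose, rs_symm hA hs]
  have h4 : R.trace - R'.trace = (1 + q)⁻¹ * ((R *ᵥ v) ⬝ᵥ (R *ᵥ v)) := by
    rw [← Matrix.trace_sub, h3, Matrix.trace_vecMulVec, h2, smul_dotProduct, smul_eq_mul]
  refine ⟨hq, ?_, ?_, ?_⟩
  · rw [h2, dotProduct_smul, smul_eq_mul]; change (1 + q)⁻¹ * q = q / (1 + q); ring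
  · rw [h4]; exact mul_nonneg (by positivity) (dot_self_nn _)
  · rw [h4, inv_mul_le_iff₀ (by positivity)]
    have h5 := rs_bd1 hA hs v
    have : (R *ᵥ v) ⬝ᵥ (R *ᵥ v) ≤ q / s := by
      rw [le_div_iff₀ hs]; linarith
    refine this.trans ?_
    rw [mul_one_div]; gcongr; linarith

/-- sum of rank ones -/
noncomputable def covM (S : Finset κ) (x : κ → ι → ℝ) : Matrix ι ι ℝ := ∑ i ∈ S, vecMulVec (x i) (x i)

theorem covM_psd (S : Finset κ) (x : κ → ι → ℝ) : (covM S x).PosSemidef :=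
  Matrix.posSemidef_sum S fun i _ => vv_psd (x i)

theorem covM_insert (x : κ → ι → ℝ) (i : κ) :
    covM Finset.univ x = covM (Finset.univ.erase i) x + vecMulVec (x i) (x i) :=
  (Finset.sum_erase_add _ _ (Finset.mem_univ i)).symm

theorem covM_eq (X : Matrix κ ι ℝ) : covM Finset.univ X = Xᵀ * X := by
  ext a b; simp [covM, Matrix.sum_apply, Matrix.mul_apply, vecMulVec_apply]

theorem rs_trace_id (x : κ → ι → ℝ) {s : ℝ} (hs : 0 < s) :
    s * (rs (covM Finset.univ x) s).trace +
      ∑ i, x i ⬝ᵥ (rs (covM Finset.univ x) s *ᵥ x i) = Fintype.card ι := by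
  have h := congrArg Matrix.trace (mul_rs (covM_psd Finset.univ x) hs)
  rw [Matrix.trace_one, Matrix.mul_add, Matrix.trace_add] at h
  rw [← h, add_comm]
  congr 1
  · conv_rhs => rw [covM]
    rw [Matrix.mul_sum, Matrix.trace_sum]
    refine Finset.sum_congr rfl fun i _ => ?_
    rw [mul_vecMulVec, Matrix.trace_vecMulVec, dotProduct_comm]
    rfl
  · simp

theorem rs_swap (X : Matrix κ ι ℝ) {s : ℝ} (hs : 0 < s) :
    (Fintype.card κ : ℝ) - s * (rs (X * Xᵀ) s).trace = Fintype.card ι - s * (rs (Xᵀ * X) s).trace := by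
  have p1 : (X * Xᵀ).PosSemidef := by simpa using Matrix.posSemidef_self_mul_conjTranspose X
  have p2 : (Xᵀ * X).PosSemidef := by simpa using Matrix.posSemidef_conjTranspose_mul_self X
  have h1 := congrArg Matrix.trace (mul_rs p1 hs)
  have h2 := congrArg Matrix.trace (mul_rs p2 hs)
  rw [Matrix.trace_one, Matrix.mul_add, Matrix.trace_add] at h1 h2
  rw [← h1, ← h2]
  have e : rs (X * Xᵀ) s * X = X * rs (Xᵀ * X) s := by
    have : rs (X * Xᵀ) s * (X * (Xᵀ * X + s • (1 : Matrix ι ι ℝ))) * rs (Xᵀ * X) s = rs (X * Xᵀ) s * X := by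
      rw [Matrix.mul_assoc, Matrix.mul_assoc X, rs_mul p2 hs, Matrix.mul_one]
    rw [← this]
    have : X * (Xᵀ * X + s • (1 : Matrix ι ι ℝ)) = (X * Xᵀ + s • (1 : Matrix κ κ ℝ)) * X := by
      simp [Matrix.mul_add, Matrix.add_mul, Matrix.mul_assoc]
    rw [this, ← Matrix.mul_assoc, mul_rs p1 hs, Matrix.one_mul]
  have e2 : (rs (X * Xᵀ) s * (X * Xᵀ)).trace = (rs (Xᵀ * X) s * (Xᵀ * X)).trace := by
    rw [← Matrix.mul_assoc, e, Matrix.mul_assoc, Matrix.trace_mul_comm, Matrix.mul_assoc]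
  rw [e2]; simp

end PartLinAlg

section PartDet
open Matrix

/-- centered vector -/
noncomputable def ctr {N : ℕ} (y : Fin N → ℝ) : Fin N → ℝ := fun α => y α - (∑ β, y β) / N

noncomputable def Xm {N K : ℕ} (μ : Fin K → Fin N → ℝ) : Fin K → Fin N → ℝ := fun i => ctr (sqv (μ i))

noncomputable def Mm {N K : ℕ} (s : ℝ) (μ : Fin K → Fin N → ℝ) (i : Fin K) : Matrix (Fin N) (Fin N) ℝ :=
  Matrix.of fun α β => rs (covM (Finset.univ.erase i) (Xm μ)) s α β - 1 / (s * N)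

theorem ctr_sum (n : ℕ) (y : Fin (n+1) → ℝ) : ∑ α, ctr y α = 0 := by
  unfold ctr
  rw [Finset.sum_sub_distrib]
  simp
  field_simp
  simp

theorem rs_ones (n K : ℕ) (s : ℝ) (hs : 0 < s) (S : Finset (Fin K)) (x : Fin K → Fin (n+1) → ℝ)
    (hx : ∀ i, ∑ α, x i α = 0) (α : Fin (n+1)) : ∑ β, rs (covM S x) s α β = 1 / s := by
  have h0 : covM S x *ᵥ (fun _ => (1:ℝ)) = 0 := by
    unfold covM
    rw [Matrix.sum_mulVec]
    refine Finset.sum_eq_zero fun i _ => ?_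
    rw [vecMulVec_mulVec]
    ext; simp [dotProduct, hx]
  have h1 : (covM S x + s • (1 : Matrix (Fin (n+1)) (Fin (n+1)) ℝ)) *ᵥ (fun _ => (1:ℝ)) = s • fun _ => (1:ℝ) := by
    rw [Matrix.add_mulVec, h0, Matrix.smul_mulVec, Matrix.one_mulVec, zero_add]
  have h2 := congrArg (fun v => (rs (covM S x) s *ᵥ v) α) h1
  simp only [Matrix.mulVec_mulVec, mul_rs (covM_psd S x) hs, Matrix.one_mulVec, Matrix.mulVec_smul] at h2
  simp only [Pi.smul_apply, smul_eq_mul, mulVec, dotProduct, mul_one] at h2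
  rw [eq_div_iff hs.ne', mul_comm]; exact h2.symm

theorem Mm_facts (n K : ℕ) (s : ℝ) (hs : 0 < s) (μ : Fin K → Fin (n+1) → ℝ) (i : Fin K) :
    (∀ α, ∑ β, Mm s μ i α β = 0) ∧ (∀ β, ∑ α, Mm s μ i α β = 0) ∧
    (∑ p : Fin (n+1) × Fin (n+1), Mm s μ i p.1 p.2 ^ 2 ≤ (n+1) / s^2) ∧
    (Mm s μ i).trace = (rs (covM (Finset.univ.erase i) (Xm μ)) s).trace - 1 / s ∧
    qf (Mm s μ i) (sqv (μ i)) = Xm μ i ⬝ᵥ (rs (covM (Finset.univ.erase i) (Xm μ)) s *ᵥ Xm μ i) := by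
  set A := covM (Finset.univ.erase i) (Xm μ) with hA
  have pA : A.PosSemidef := covM_psd _ _
  have hx : ∀ j, ∑ α, Xm μ j α = 0 := fun j => ctr_sum n _
  have r1 : ∀ α, ∑ β, rs A s α β = 1 / s := rs_ones n K s hs _ _ hx
  have hN : ((n:ℝ) + 1) ≠ 0 := by positivity
  have f1 : ∀ α, ∑ β, Mm s μ i α β = 0 := by
    intro α
    simp only [Mm, Matrix.of_apply, Finset.sum_sub_distrib]
    rw [← hA, r1]
    simp
    field_simp
    simp
  have sym : ∀ α β, rs A s α β = rs A s β α := by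
    intro α β
    conv_lhs => rw [← rs_symm pA hs, Matrix.transpose_apply]
  have symM : ∀ α β, Mm s μ i α β = Mm s μ i β α := by
    intro α β; simp only [Mm, Matrix.of_apply, ← hA]; rw [sym]
  have f2 : ∀ β, ∑ α, Mm s μ i α β = 0 := by
    intro β; simp only [symM _ β]; exact f1 β
  refine ⟨f1, f2, ?_, ?_, ?_⟩
  · have h := rs_sq pA hs
    have e : ∑ p : Fin (n+1) × Fin (n+1), Mm s μ i p.1 p.2 ^ 2 =
        ∑ p : Fin (n+1) × Fin (n+1), rs A s p.1 p.2 ^ 2 - 1 / s^2 := by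
      simp only [Mm, Matrix.of_apply, ← hA, sub_sq, Finset.sum_add_distrib, Finset.sum_sub_distrib]
      have : ∑ p : Fin (n+1) × Fin (n+1), 2 * rs A s p.1 p.2 * (1 / (s * ((n+1 : ℕ):ℝ))) = 2 / s^2 := by
        rw [Fintype.sum_prod_type]
        simp only [← Finset.sum_mul, ← Finset.mul_sum, r1]
        simp
        field_simp
      rw [this]
      simp
      field_simp
      ring
    rw [e]
    have : 0 < 1 / s^2 := by positivity
    simp only [Fintype.card_fin, Nat.cast_add, Nat.cast_one] at h
    linarith
  · simp only [Matrix.trace, Matrix.diag, Mm, Matrix.of_apply, Finset.sum_sub_distrib, ← hA]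
    simp
    field_simp
  · rw [qf_shift _ f1 f2 _ ((∑ β, sqv (μ i) β) / ((n+1:ℕ):ℝ))]
    have : (fun α => sqv (μ i) α - (∑ β, sqv (μ i) β) / ((n+1:ℕ):ℝ)) = Xm μ i := rfl
    rw [this]
    unfold qf
    simp only [Mm, Matrix.of_apply, ← hA, sub_mul, Finset.sum_sub_distrib]
    have z : ∑ p : Fin (n+1) × Fin (n+1), 1 / (s * ((n+1 : ℕ):ℝ)) * (Xm μ i p.1 * Xm μ i p.2) = 0 := by
      rw [Fintype.sum_prod_type]
      simp only [← Finset.mul_sum, hx]; simp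
    rw [z, sub_zero, Fintype.sum_prod_type]
    simp only [dotProduct, mulVec, Finset.mul_sum]
    refine Finset.sum_congr rfl fun α _ => Finset.sum_congr rfl fun β _ => by ring

theorem gram_dec (n K : ℕ) (μ : Fin K → Fin (n+1) → ℝ) (hμ : ∀ i α, 0 ≤ μ i α) :
    gramMatrix μ = (Matrix.of (Xm μ)) * (Matrix.of (Xm μ))ᵀ +
      vecMulVec (fun i => (∑ α, sqv (μ i) α) / Real.sqrt (n+1)) (fun i => (∑ α, sqv (μ i) α) / Real.sqrt (n+1)) := by
  ext i j
  simp only [gramMatrix, affinity, Matrix.of_apply, Matrix.add_apply, Matrix.mul_apply, Matrix.transpose_apply,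
    vecMulVec_apply, Xm, ctr]
  have h1 : ∀ α, Real.sqrt (μ i α * μ j α) = sqv (μ i) α * sqv (μ j) α := fun α => Real.sqrt_mul (hμ i α) _
  simp only [h1]
  set S := ∑ α, sqv (μ i) α
  set T := ∑ α, sqv (μ j) α
  have e : ∀ α, (sqv (μ i) α - S / ((n+1:ℕ):ℝ)) * (sqv (μ j) α - T / ((n+1:ℕ):ℝ)) =
    sqv (μ i) α * sqv (μ j) α - S / ((n+1:ℕ):ℝ) * sqv (μ j) α - T / ((n+1:ℕ):ℝ) * sqv (μ i) α
      + S / ((n+1:ℕ):ℝ) * (T / ((n+1:ℕ):ℝ)) := by intro α; ring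
  simp only [e, Finset.sum_add_distrib, Finset.sum_sub_distrib, ← Finset.mul_sum]
  have h2 : S / Real.sqrt (n+1) * (T / Real.sqrt (n+1)) = S * T / (n+1) := by
    rw [div_mul_div_comm, Real.mul_self_sqrt (by positivity)]
  rw [h2]
  simp only [Finset.sum_const, Finset.card_univ, Fintype.card_fin, nsmul_eq_mul]
  push_cast
  change _ = _ - S / (n+1) * T - T / (n+1) * S + _ + _
  field_simp
  ring

theorem frac_lip (p q : ℝ) (hp : 0 ≤ p) (hq : 0 ≤ q) : |p/(1+p) - q/(1+q)| ≤ |p - q| := by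
  have : p/(1+p) - q/(1+q) = (p - q) / ((1+p)*(1+q)) := by field_simp; ring
  rw [this, abs_div, abs_of_pos (show 0 < (1+p)*(1+q) by positivity)]
  exact div_le_self (abs_nonneg _) (by nlinarith [mul_nonneg hp hq])

noncomputable def Err {N K : ℕ} (a s : ℝ) (μ : Fin K → Fin N → ℝ) (i : Fin K) : ℝ :=
  qf (Mm s μ i) (sqv (μ i)) - a / N * (Mm s μ i).trace

theorem det_main (n K : ℕ) (a s : ℝ) (ha : 0 < a) (hs : 0 < s) (μ : Fin K → Fin (n+1) → ℝ)
    (hμ : ∀ i α, 0 ≤ μ i α) : ∃ g : ℝ, 0 ≤ g ∧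
    |1 - s / a * g - (K / (n+1)) * (g/(1+g))| ≤ 1/(n+1) * ∑ i, |Err a s μ i| + (K/(n+1)) * (2 * a / ((n+1) * s)) ∧
    |(rs (gramMatrix μ) s).trace - ((K - (n+1)) / s + (n+1) * g / a)| ≤ 1 / s := by
  set x := Xm μ with hx
  set A := covM Finset.univ x with hA
  have pA : A.PosSemidef := covM_psd _ _
  set T := (rs A s).trace with hT
  have hT0 : 0 ≤ T := (rs_trace pA hs).1
  have hN : (0:ℝ) < n + 1 := by positivity
  set g := a / (n+1) * T with hg
  have hg0 : 0 ≤ g := by positivity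
  refine ⟨g, hg0, ?_, ?_⟩
  · set q : Fin K → ℝ := fun i => x i ⬝ᵥ (rs (covM (Finset.univ.erase i) x) s *ᵥ x i) with hq
    have r1 := fun i => rs_rank1 (covM_psd (Finset.univ.erase i) x) hs (x i)
    have hid := rs_trace_id x hs
    have hq1 : ∀ i, x i ⬝ᵥ (rs A s *ᵥ x i) = q i / (1 + q i) := by
      intro i
      have := (r1 i).2.1
      rw [← covM_insert x i] at this
      exact this
    rw [← hA, ← hT] at hid
    simp only [hq1, Fintype.card_fin, Nat.cast_add, Nat.cast_one] at hid
    have e1 : 1 - s / a * g - (K / (n+1)) * (g/(1+g)) = 1 / (n+1) * ∑ i, (q i / (1 + q i) - g/(1+g)) := by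
      rw [Finset.sum_sub_distrib]
      have : ∑ i, q i / (1 + q i) = (n+1) - s * T := by linarith
      rw [this]
      simp only [Finset.sum_const, Finset.card_univ, Fintype.card_fin, nsmul_eq_mul, hg]
      have h3 : 1 + a / (n+1) * T ≠ 0 := by positivity
      field_simp
    rw [e1, abs_mul, abs_of_pos (by positivity)]
    have hterm : ∀ i, |q i / (1 + q i) - g/(1+g)| ≤ |Err a s μ i| + 2 * a / ((n+1) * s) := by
      intro i
      refine (frac_lip _ _ (r1 i).1 hg0).trans ?_
      obtain ⟨-, -, -, m4, m5⟩ := Mm_facts n K s hs μ i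
      rw [← hx] at m4 m5
      have e2 : q i - g = Err a s μ i + a / (n+1) * (((rs (covM (Finset.univ.erase i) x) s).trace - T) - 1 / s) := by
        unfold Err
        rw [m4, m5]
        push_cast
        simp only [hq, hg]; ring
      rw [e2]
      refine (abs_add_le _ _).trans ?_
      gcongr
      have t3 := (r1 i).2.2
      rw [← covM_insert x i] at t3
      obtain ⟨t1, t2⟩ := t3
      rw [abs_mul, abs_of_pos (by positivity)]
      have : |((rs (covM (Finset.univ.erase i) x) s).trace - T) - 1 / s| ≤ 2 * (1 / s) := by
        have : 0 < 1 / s := by positivity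
        rw [abs_le]; constructor <;> linarith
      calc _ ≤ a / (n+1) * (2 * (1/s)) := by gcongr
        _ = _ := by field_simp
    calc _ ≤ 1/(n+1) * ∑ i, (|Err a s μ i| + 2 * a / ((n+1) * s)) := by
          gcongr
          exact (Finset.abs_sum_le_sum_abs _ _).trans (Finset.sum_le_sum fun i _ => hterm i)
      _ = _ := by
          rw [Finset.sum_add_distrib]
          simp only [Finset.sum_const, Finset.card_univ, Fintype.card_fin, nsmul_eq_mul]
          ring
  · have h1 := rs_swap (Matrix.of x) hs
    rw [← covM_eq] at h1
    simp only [Fintype.card_fin, Nat.cast_add, Nat.cast_one] at h1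
    have h2 : s * (rs (Matrix.of x * (Matrix.of x)ᵀ) s).trace = K - (n+1) + s * T := by
      have : (rs (covM Finset.univ (Matrix.of x)) s).trace = T := rfl
      rw [this] at h1; linarith
    have h3 : (K - (n+1)) / s + (n+1) * g / a = (rs (Matrix.of x * (Matrix.of x)ᵀ) s).trace := by
      rw [eq_comm, ← mul_right_inj' hs.ne', h2, hg]
      field_simp
    rw [h3, gram_dec n K μ hμ, ← hx]
    have p1 : (Matrix.of x * (Matrix.of x)ᵀ).PosSemidef := by
      simpa using Matrix.posSemidef_self_mul_conjTranspose (Matrix.of x)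
    obtain ⟨-, -, t1, t2⟩ := rs_rank1 p1 hs (fun i => (∑ α, sqv (μ i) α) / Real.sqrt (n+1))
    rw [abs_le]; constructor <;> linarith

end PartDet

section PartErr
open Matrix

theorem rs_cont {X : Type*} [TopologicalSpace X] {N : ℕ} (B : X → Matrix (Fin N) (Fin N) ℝ) (hB : Continuous B)
    (hp : ∀ x, (B x).PosSemidef) {s : ℝ} (hs : 0 < s) : Continuous fun x => rs (B x) s := by
  unfold rs
  simp only [Matrix.inv_def, Ring.inverse_eq_inv']
  have h : Continuous fun x => B x + s • (1 : Matrix (Fin N) (Fin N) ℝ) := hB.add continuous_const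
  exact (h.matrix_det.inv₀ fun x => (rs_isUnit (hp x) hs).ne_zero).smul h.matrix_adjugate

theorem sqv_cont {N : ℕ} : Continuous (sqv (N := N)) := by unfold sqv; fun_prop

theorem Xm_cont {N K : ℕ} : Continuous (Xm (N := N) (K := K)) := by
  unfold Xm ctr sqv; fun_prop

theorem covM_cont {N K : ℕ} (S : Finset (Fin K)) : Continuous fun μ : Fin K → Fin N → ℝ => covM S (Xm μ) := by
  unfold covM
  refine continuous_finsetSum _ fun i _ => ?_
  have : Continuous fun μ : Fin K → Fin N → ℝ => Xm μ i := (continuous_apply i).comp Xm_cont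
  exact this.matrix_vecMulVec this

theorem Mm_cont {N K : ℕ} {s : ℝ} (hs : 0 < s) (i : Fin K) :
    Continuous fun μ : Fin K → Fin N → ℝ => Mm s μ i := by
  have := rs_cont (fun μ : Fin K → Fin N → ℝ => covM (Finset.univ.erase i) (Xm μ)) (covM_cont _) (fun μ => covM_psd _ _) hs
  refine continuous_matrix fun α β => ?_
  simp only [Mm, Matrix.of_apply]
  exact (this.matrix_elem α β).sub continuous_const

theorem Err_cont {N K : ℕ} (a : ℝ) {s : ℝ} (hs : 0 < s) (i : Fin K) :
    Continuous fun μ : Fin K → Fin N → ℝ => Err a s μ i := by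
  have h := Mm_cont (N := N) (K := K) hs i
  have h2 : Continuous fun μ : Fin K → Fin N → ℝ => sqv (μ i) := sqv_cont.comp (continuous_apply i)
  unfold Err qf
  refine Continuous.sub (continuous_finsetSum _ fun p _ => (h.matrix_elem _ _).mul ?_)
    (continuous_const.mul h.matrix_trace)
  exact ((continuous_apply _).comp h2).mul ((continuous_apply _).comp h2)

theorem Mm_update {N K : ℕ} (s : ℝ) (μ : Fin K → Fin N → ℝ) (i : Fin K) (ν : Fin N → ℝ) :
    Mm s (Function.update μ i ν) i = Mm s μ i := by
  have : covM (Finset.univ.erase i) (Xm (Function.update μ i ν)) = covM (Finset.univ.erase i) (Xm μ) := by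
    unfold covM
    refine Finset.sum_congr rfl fun j hj => ?_
    have : Xm (Function.update μ i ν) j = Xm μ j := by
      unfold Xm; rw [Function.update_of_ne (Finset.ne_of_mem_erase hj)]
    rw [this]
  unfold Mm; rw [this]

theorem Err_bound : ∃ C : ℝ, 0 ≤ C ∧ ∀ (n K : ℕ) (s : ℝ), 0 < s → ∀ i : Fin K,
    ∫⁻ μ, ENNReal.ofReal (Err (1 - Real.pi/4) s μ i ^ 2) ∂(Measure.pi fun _ : Fin K => uniformSimplex (n+1))
      ≤ ENNReal.ofReal (C / (s^2 * (n+1))) := by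
  obtain ⟨C, hC, h⟩ := simplex_quad
  refine ⟨C, hC, fun n K s hs i => ?_⟩
  have hU := uniformSimplex_prob n
  have hc := Err_cont (N := n+1) (1 - Real.pi/4) hs i
  have hm : Measurable fun μ : Fin K → Fin (n+1) → ℝ => ENNReal.ofReal (Err (1 - Real.pi/4) s μ i ^ 2) :=
    ENNReal.measurable_ofReal.comp (hc.measurable.pow_const 2)
  have key := lintegral_le_of_lmarginal_le (μ := fun _ : Fin K => uniformSimplex (n+1)) {i} hm
    (measurable_const (a := ENNReal.ofReal (C / (s^2 * (n+1))))) ?_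
  · refine key.trans ?_
    simp
  · intro μ
    rw [lmarginal_singleton, lmarginal_singleton]
    simp only [lintegral_const, measure_univ, mul_one]
    obtain ⟨f1, f2, f3, -, -⟩ := Mm_facts n K s hs μ i
    obtain ⟨h1, h2⟩ := h n (Mm s μ i) f1 f2
    have e : ∀ ν : Fin (n+1) → ℝ, Err (1 - Real.pi/4) s (Function.update μ i ν) i ^ 2 =
        (qf (Mm s μ i) (sqv ν) - (1 - Real.pi/4) / (n+1) * (Mm s μ i).trace)^2 := by
      intro ν
      unfold Err
      rw [Mm_update, Function.update_self]; push_cast; rfl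
    simp only [e]
    rw [← ofReal_integral_eq_lintegral_ofReal h1 (Filter.Eventually.of_forall fun _ => sq_nonneg _)]
    refine ENNReal.ofReal_le_ofReal (h2.trans ?_)
    calc _ ≤ C * ((n+1) / s^2) / (n+1)^2 := by gcongr
      _ = _ := by field_simp

theorem Err_int : ∃ C : ℝ, 0 ≤ C ∧ ∀ (n K : ℕ) (s : ℝ), 0 < s → ∀ i : Fin K,
    Integrable (fun μ => |Err (1 - Real.pi/4) s μ i|) (Measure.pi fun _ : Fin K => uniformSimplex (n+1)) ∧
    ∫ μ, |Err (1 - Real.pi/4) s μ i| ∂(Measure.pi fun _ : Fin K => uniformSimplex (n+1))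
      ≤ (C / s^2 + 1) / Real.sqrt (n+1) := by
  obtain ⟨C, hC, h⟩ := Err_bound
  refine ⟨C, hC, fun n K s hs i => ?_⟩
  have hU := uniformSimplex_prob n
  set P := Measure.pi fun _ : Fin K => uniformSimplex (n+1) with hP
  set F := fun μ : Fin K → Fin (n+1) → ℝ => Err (1 - Real.pi/4) s μ i with hF
  have hc : Continuous F := Err_cont (N := n+1) (1 - Real.pi/4) hs i
  have hb := h n K s hs i
  have i2 : Integrable (fun μ => F μ ^ 2) P := by
    refine ⟨(hc.pow 2).aestronglyMeasurable, ?_⟩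
    rw [hasFiniteIntegral_iff_ofReal (Filter.Eventually.of_forall fun _ => sq_nonneg _)]
    exact hb.trans_lt ENNReal.ofReal_lt_top
  have b2 : ∫ μ, F μ ^ 2 ∂P ≤ C / (s^2 * (n+1)) := by
    rw [← ENNReal.ofReal_le_ofReal_iff (by positivity), ofReal_integral_eq_lintegral_ofReal i2
      (Filter.Eventually.of_forall fun _ => sq_nonneg _)]
    exact hb
  set r := Real.sqrt (n+1) with hr
  have hr0 : 0 < r := Real.sqrt_pos.2 (by positivity)
  have hr2 : r^2 = n+1 := Real.sq_sqrt (by positivity)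
  have pt : ∀ μ, |F μ| ≤ r * F μ ^ 2 + 1 / r := by
    intro μ
    have : 0 ≤ (r * |F μ| - 1)^2 := sq_nonneg _
    have h0 := abs_nonneg (F μ)
    have e : r * F μ ^ 2 + 1 / r - |F μ| = ((r * |F μ| - 1)^2 + r * |F μ|) / r := by
      rw [← sq_abs (F μ)]; field_simp; ring
    have : 0 ≤ r * F μ ^ 2 + 1 / r - |F μ| := by rw [e]; positivity
    linarith
  have hi : Integrable (fun μ => r * F μ ^ 2 + 1 / r) P := (i2.const_mul r).add (integrable_const _)
  have i1 : Integrable (fun μ => |F μ|) P := hi.mono' hc.abs.aestronglyMeasurable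
    (Filter.Eventually.of_forall fun μ => by simpa using pt μ)
  refine ⟨i1, ?_⟩
  have m := integral_mono i1 hi pt
  have e : ∫ μ, (r * F μ ^ 2 + 1 / r) ∂P = r * ∫ μ, F μ ^ 2 ∂P + 1 / r := by
    have := integral_add (i2.const_mul r) (integrable_const (μ := P) (1/r))
    rw [integral_const_mul] at this
    simpa using this
  rw [e] at m
  refine m.trans ?_
  have : r * ∫ μ, F μ ^ 2 ∂P ≤ r * (C / (s^2 * (n+1))) := by gcongr
  refine (add_le_add_left this _).trans (le_of_eq ?_)
  rw [← hr2]; field_simp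

end PartErr

section PartRes
open Matrix Filter Topology

theorem gram_psd (n K : ℕ) (μ : Fin K → Fin (n+1) → ℝ) (hμ : ∀ i α, 0 ≤ μ i α) :
    (gramMatrix μ).PosSemidef := by
  rw [gram_dec n K μ hμ]
  have p1 : (Matrix.of (Xm μ) * (Matrix.of (Xm μ))ᵀ).PosSemidef := by
    simpa using Matrix.posSemidef_self_mul_conjTranspose (Matrix.of (Xm μ))
  exact p1.add (vv_psd _)

theorem gram_cont (N K : ℕ) : Continuous fun μ : Fin K → Fin N → ℝ => gramMatrix μ := by
  refine continuous_matrix fun i j => ?_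
  simp only [gramMatrix, affinity, Matrix.of_apply]
  fun_prop

theorem rs_gram_meas (N K : ℕ) (s : ℝ) : Measurable fun μ : Fin K → Fin N → ℝ => (rs (gramMatrix μ) s).trace := by
  unfold rs
  simp only [Matrix.inv_def, Ring.inverse_eq_inv', Matrix.trace_smul]
  have h : Continuous fun μ : Fin K → Fin N → ℝ => gramMatrix μ + s • (1 : Matrix (Fin K) (Fin K) ℝ) :=
    (gram_cont N K).add continuous_const
  have h1 := h.matrix_det.measurable
  have h2 := h.matrix_adjugate.matrix_trace.measurable
  exact h1.inv.mul h2

theorem pi_simplex_ae (n K : ℕ) : ∀ᵐ μ ∂(Measure.pi fun _ : Fin K => uniformSimplex (n+1)),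
    ∀ i, μ i ∈ stdSimplex ℝ (Fin (n+1)) := by
  have hU := uniformSimplex_prob n
  rw [ae_all_iff]
  intro i
  exact (Measure.quasiMeasurePreserving_eval (fun _ : Fin K => uniformSimplex (n+1)) i).ae
    (uniformSimplex_ae (n+1))

/-- positive root -/
noncomputable def gst (τ t : ℝ) : ℝ := (-(t + τ - 1) + Real.sqrt ((1+τ+t)^2 - 4*τ)) / (2 * t)

theorem gst_facts (τ t : ℝ) (hτ : 0 < τ) (ht : 0 < t) : 0 ≤ gst τ t ∧
    1 - t * gst τ t - τ * (gst τ t / (1 + gst τ t)) = 0 := by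
  have hD : 0 ≤ (1+τ+t)^2 - 4*τ := by nlinarith [sq_nonneg (τ-1), mul_pos hτ ht]
  have hD' : |t + τ - 1| ≤ Real.sqrt ((1+τ+t)^2 - 4*τ) := by
    apply Real.abs_le_sqrt; nlinarith
  have h0 : 0 ≤ gst τ t := by
    unfold gst
    apply div_nonneg _ (by positivity)
    linarith [le_abs_self (t + τ - 1)]
  refine ⟨h0, ?_⟩
  have hq : t * gst τ t ^ 2 + (t + τ - 1) * gst τ t - 1 = 0 := by
    have e : 2 * t * gst τ t = -(t + τ - 1) + Real.sqrt ((1+τ+t)^2 - 4*τ) := by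
      unfold gst; field_simp
    have hs := Real.sq_sqrt hD
    have e2 : Real.sqrt ((1+τ+t)^2 - 4*τ) = 2 * t * gst τ t + (t + τ - 1) := by linarith
    rw [e2] at hs
    have : 4 * t * (t * gst τ t ^ 2 + (t + τ - 1) * gst τ t - 1) = 0 := by linarith
    have h4 : 4 * t ≠ 0 := by positivity
    exact (mul_eq_zero.1 this).resolve_left h4
  have : 1 + gst τ t ≠ 0 := by positivity
  field_simp
  linarith

theorem phi_stab (τ t g h : ℝ) (hτ : 0 < τ) (ht : 0 < t) (hg : 0 ≤ g) (hh : 0 ≤ h)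
    (h0 : 1 - t * h - τ * (h/(1+h)) = 0) : |g - h| ≤ 1 / t * |1 - t * g - τ * (g/(1+g))| := by
  rw [one_div, ← div_eq_inv_mul, le_div_iff₀ ht]
  have e : 1 - t * g - τ * (g/(1+g)) = -((g - h) * (t + τ / ((1+g)*(1+h)))) := by
    have : 1 - t * g - τ * (g/(1+g)) = (1 - t * g - τ * (g/(1+g))) - (1 - t * h - τ * (h/(1+h))) := by
      rw [h0, sub_zero]
    rw [this]; field_simp; ring
  rw [e, abs_neg, abs_mul]
  have : t ≤ |t + τ / ((1+g)*(1+h))| := by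
    refine le_trans ?_ (le_abs_self _)
    have : 0 ≤ τ / ((1+g)*(1+h)) := by positivity
    linarith
  gcongr

noncomputable def resLim (τ a s : ℝ) : ℝ := (1 - 1/τ) / s + gst τ (s/a) / (a * τ)

noncomputable def bnd (C τ a s κ N : ℝ) : ℝ := 1/(s*κ*N) + |1/κ - 1/τ| * (1/s + gst τ (s/a)/a)
  + 1/(s*κ) * (κ * ((C/s^2+1)/Real.sqrt N) + κ * (2*a/(N*s)) + |κ - τ|)

theorem res_pointwise (n K : ℕ) (hK : 0 < K) (τ a s : ℝ) (hτ : 0 < τ) (ha : 0 < a) (hs : 0 < s)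
    (μ : Fin K → Fin (n+1) → ℝ) (hμ : ∀ i α, 0 ≤ μ i α) (κ : ℝ) (hκ : κ = K / (n+1)) :
    |1 / (K:ℝ) * (rs (gramMatrix μ) s).trace - resLim τ a s| ≤
      1/(s*κ*(n+1)) + |1/κ - 1/τ| * (1/s + gst τ (s/a)/a)
      + 1/(s*κ) * (1/(n+1) * ∑ i, |Err a s μ i| + κ * (2*a/((n+1)*s)) + |κ - τ|) := by
  obtain ⟨g, hg0, hg1, hg2⟩ := det_main n K a s ha hs μ hμ
  obtain ⟨h0, h1⟩ := gst_facts τ (s/a) hτ (by positivity)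
  have hK' : (0:ℝ) < K := by exact_mod_cast hK
  have hκ0 : 0 < κ := by rw [hκ]; positivity
  rw [← hκ] at hg1
  have hst := phi_stab τ (s/a) g _ hτ (by positivity) hg0 h0 h1
  set G := gst τ (s/a) with hG
  set T := (rs (gramMatrix μ) s).trace with hT
  set S := 1/((n:ℝ)+1) * ∑ i, |Err a s μ i| with hS
  have hφ : |1 - s/a * g - τ * (g/(1+g))| ≤ S + κ * (2*a/((n+1)*s)) + |κ - τ| := by
    have e : 1 - s/a * g - τ * (g/(1+g)) = (1 - s/a * g - κ * (g/(1+g))) + (κ - τ) * (g/(1+g)) := by ring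
    rw [e]
    refine (abs_add_le _ _).trans (add_le_add hg1 ?_)
    rw [abs_mul]
    refine mul_le_of_le_one_right (abs_nonneg _) ?_
    rw [abs_of_nonneg (by positivity), div_le_one (by positivity)]; linarith
  set Q := S + κ * (2*a/((n+1)*s)) + |κ - τ| with hQ
  have hgG : |g - G| ≤ a / s * Q := by
    refine hst.trans ?_
    rw [one_div_div]; gcongr
  have hKκ : (K:ℝ) = κ * (n+1) := by rw [hκ]; field_simp
  have e : 1 / (K:ℝ) * T - resLim τ a s = 1/(K:ℝ) * (T - ((K - (n+1)) / s + (n+1) * g / a)) +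
      (-(1/κ - 1/τ)) / s + ((1/κ - 1/τ) * (G / a) + 1/(κ * a) * (g - G)) := by
    unfold resLim
    rw [← hG, hKκ]; field_simp; ring
  rw [e]
  have b1 : |1/(K:ℝ) * (T - ((K - (n+1)) / s + (n+1) * g / a))| ≤ 1/(s*κ*(n+1)) := by
    rw [abs_mul, abs_of_pos (by positivity)]
    calc _ ≤ 1/(K:ℝ) * (1/s) := by gcongr
      _ = _ := by rw [hKκ]; field_simp
  have b2 : |(-(1/κ - 1/τ)) / s| = |1/κ - 1/τ| * (1/s) := by
    rw [abs_div, abs_neg, abs_of_pos hs]; ring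
  have b3 : |(1/κ - 1/τ) * (G / a)| = |1/κ - 1/τ| * (G/a) := by
    rw [abs_mul, abs_of_nonneg (by positivity : 0 ≤ G/a)]
  have b4 : |1/(κ * a) * (g - G)| ≤ 1/(s*κ) * Q := by
    rw [abs_mul, abs_of_pos (by positivity)]
    calc _ ≤ 1/(κ*a) * (a / s * Q) := by gcongr
      _ = _ := by field_simp
  refine (abs_add_le _ _).trans ?_
  have c1 := abs_add_le (1/(K:ℝ) * (T - ((K - (n+1)) / s + (n+1) * g / a))) ((-(1/κ - 1/τ)) / s)
  have c2 := abs_add_le ((1/κ - 1/τ) * (G / a)) (1/(κ * a) * (g - G))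
  rw [b2] at c1
  rw [b3] at c2
  linarith

theorem quarter_pos : 0 < 1 - Real.pi / 4 := by linarith [Real.pi_lt_four]

theorem res_integral_bound : ∃ C : ℝ, 0 ≤ C ∧ ∀ (n K : ℕ) (τ s : ℝ), 0 < K → 0 < τ → 0 < s →
    |∫ μ, 1 / (K:ℝ) * (rs (gramMatrix μ) s).trace ∂(Measure.pi fun _ : Fin K => uniformSimplex (n+1))
      - resLim τ (1 - Real.pi/4) s| ≤ bnd C τ (1 - Real.pi/4) s (K/(n+1)) (n+1) := by
  obtain ⟨C, hC, h⟩ := Err_int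
  refine ⟨C, hC, fun n K τ s hK hτ hs => ?_⟩
  have hU := uniformSimplex_prob n
  set P := Measure.pi fun _ : Fin K => uniformSimplex (n+1) with hP
  have ha := quarter_pos
  set a := 1 - Real.pi/4 with hadef
  have hK' : (0:ℝ) < K := by exact_mod_cast hK
  set κ : ℝ := K/(n+1) with hκ
  have hκ0 : 0 < κ := by positivity
  have hae := pi_simplex_ae n K
  set F := fun μ : Fin K → Fin (n+1) → ℝ => 1 / (K:ℝ) * (rs (gramMatrix μ) s).trace with hF
  have hFm : Measurable F := (rs_gram_meas _ _ s).const_mul _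
  set L := resLim τ a s
  set Bd := fun μ : Fin K → Fin (n+1) → ℝ => 1/(s*κ*(n+1)) + |1/κ - 1/τ| * (1/s + gst τ (s/a)/a)
      + 1/(s*κ) * (1/(n+1) * ∑ i, |Err a s μ i| + κ * (2*a/((n+1)*s)) + |κ - τ|) with hBd
  have pt : ∀ᵐ μ ∂P, |F μ - L| ≤ Bd μ := by
    filter_upwards [hae] with μ hμ
    exact res_pointwise n K hK τ a s hτ ha hs μ (fun i => (hμ i).1) κ rfl
  have iE : Integrable (fun μ : Fin K → Fin (n+1) → ℝ => ∑ i, |Err a s μ i|) P :=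
    integrable_finsetSum _ fun i _ => (h n K s hs i).1
  set c0 := 1/(s*κ*(n+1)) + |1/κ - 1/τ| * (1/s + gst τ (s/a)/a) + 1/(s*κ) * (κ * (2*a/((n+1)*s)) + |κ - τ|)
  set c1 := 1/(s*κ) * (1/((n:ℝ)+1))
  have eB : ∀ μ, Bd μ = c1 * (∑ i, |Err a s μ i|) + c0 := by
    intro μ; simp only [hBd, c0, c1]; ring
  have iB : Integrable Bd P := by
    have : Bd = fun μ => c1 * (∑ i, |Err a s μ i|) + c0 := funext eB
    rw [this]
    exact (iE.const_mul c1).add (integrable_const c0)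
  have iFL : Integrable (fun μ => F μ - L) P := iB.mono' (hFm.sub_const L).aestronglyMeasurable (by
    simpa using pt)
  have iF : Integrable F P := by
    have := iFL.add (integrable_const L)
    refine this.congr (Eventually.of_forall fun μ => ?_)
    simp
  have e1 : ∫ μ, F μ ∂P - L = ∫ μ, (F μ - L) ∂P := by
    rw [integral_sub iF (integrable_const L)]; simp
  rw [e1]
  refine (abs_integral_le_integral_abs).trans ?_
  refine (integral_mono_ae iFL.abs iB pt).trans ?_
  have e2 : ∫ μ, Bd μ ∂P = c1 * (∑ i, ∫ μ, |Err a s μ i| ∂P) + c0 := by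
    simp only [eB]
    have := integral_add (iE.const_mul c1) (integrable_const (μ := P) c0)
    rw [integral_const_mul, integral_finsetSum _ fun i _ => (h n K s hs i).1] at this
    simpa using this
  rw [e2]
  have e3 : ∑ i, ∫ μ, |Err a s μ i| ∂P ≤ K * ((C / s^2 + 1) / Real.sqrt (n+1)) := by
    refine (Finset.sum_le_sum fun i _ => (h n K s hs i).2).trans ?_
    simp
  calc _ ≤ c1 * (K * ((C / s^2 + 1) / Real.sqrt (n+1))) + c0 := by
        gcongr
    _ = _ := by
        simp only [bnd, c0, c1]
        have : (1/((n:ℝ)+1)) * (K * ((C / s^2 + 1) / Real.sqrt (n+1))) = κ * ((C / s^2 + 1) / Real.sqrt (n+1)) := by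
          rw [hκ]; ring
        rw [mul_assoc, this]; ring

theorem bnd_tendsto (C τ a s : ℝ) (hτ : 0 < τ) (hs : 0 < s) (κ : ℕ → ℝ)
    (hκ : Tendsto κ atTop (𝓝 τ)) :
    Tendsto (fun N : ℕ => bnd C τ a s (κ N) N) atTop (𝓝 0) := by
  unfold bnd
  have hN : Tendsto (fun N : ℕ => (N:ℝ)) atTop atTop := tendsto_natCast_atTop_atTop
  have hinv : Tendsto (fun N : ℕ => 1 / κ N) atTop (𝓝 (1/τ)) := tendsto_const_nhds.div hκ hτ.ne'
  have hi : Tendsto (fun N : ℕ => ((N:ℝ))⁻¹) atTop (𝓝 0) := tendsto_inv_atTop_zero.comp hN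
  have hi2 : Tendsto (fun N : ℕ => (Real.sqrt (N:ℝ))⁻¹) atTop (𝓝 0) :=
    tendsto_inv_atTop_zero.comp (Real.tendsto_sqrt_atTop.comp hN)
  have h1 : Tendsto (fun N : ℕ => 1/(s * κ N * N)) atTop (𝓝 0) := by
    have := (hinv.const_mul (1/s)).mul hi
    rw [mul_zero] at this
    refine this.congr fun N => ?_
    rw [one_div, one_div, one_div, mul_inv, mul_inv]
  have h2 : Tendsto (fun N : ℕ => |1/κ N - 1/τ| * (1/s + gst τ (s/a)/a)) atTop (𝓝 0) := by
    have := ((hinv.sub_const (1/τ)).abs).mul_const (1/s + gst τ (s/a)/a)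
    simpa using this
  have h3 : Tendsto (fun N : ℕ => 1/(s * κ N)) atTop (𝓝 (1/(s*τ))) :=
    tendsto_const_nhds.div (hκ.const_mul s) (by positivity)
  have h4 : Tendsto (fun N : ℕ => κ N * ((C/s^2+1)/Real.sqrt N)) atTop (𝓝 0) := by
    have := hκ.mul (hi2.const_mul (C/s^2+1))
    simpa [div_eq_mul_inv] using this
  have h5 : Tendsto (fun N : ℕ => κ N * (2*a/(N*s))) atTop (𝓝 0) := by
    have := hκ.mul (hi.const_mul (2*a/s))
    rw [mul_zero, mul_zero] at this
    refine this.congr fun N => ?_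
    field_simp
  have h6 : Tendsto (fun N : ℕ => |κ N - τ|) atTop (𝓝 0) := by
    have := (hκ.sub_const τ).abs
    simpa using this
  have := (h1.add h2).add (h3.mul ((h4.add h5).add h6))
  simpa using this

theorem K_pos_ev (τ : ℝ) (hτ : 0 < τ) (K : ℕ → ℕ)
    (hK : Tendsto (fun N => (K N : ℝ) / N) atTop (𝓝 τ)) : ∀ᶠ N in atTop, 0 < K N := by
  filter_upwards [hK.eventually (lt_mem_nhds hτ)] with N hN
  by_contra h
  have : K N = 0 := by omega
  rw [this] at hN; simp at hN

theorem res_conv (τ : ℝ) (hτ : 0 < τ) (K : ℕ → ℕ)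
    (hK : Tendsto (fun N => (K N : ℝ) / N) atTop (𝓝 τ)) (s : ℝ) (hs : 0 < s) :
    Tendsto (fun N => ∫ μ : Fin (K N) → (Fin N → ℝ), 1 / (K N : ℝ) * (rs (gramMatrix μ) s).trace
      ∂(Measure.pi fun _ : Fin (K N) => uniformSimplex N)) atTop (𝓝 (resLim τ (1 - Real.pi/4) s)) := by
  obtain ⟨C, hC, h⟩ := res_integral_bound
  rw [tendsto_iff_norm_sub_tendsto_zero]
  refine squeeze_zero' (Eventually.of_forall fun _ => norm_nonneg _) ?_
    (bnd_tendsto C τ (1 - Real.pi/4) s hτ hs _ hK)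
  filter_upwards [K_pos_ev τ hτ K hK, eventually_ge_atTop 1] with N hKN hN
  generalize K N = k at *
  obtain ⟨n, rfl⟩ : ∃ n, N = n + 1 := ⟨N - 1, by omega⟩
  have := h n k τ s hKN hτ hs
  rw [Real.norm_eq_abs]
  push_cast
  exact this

end PartRes

section PartMP
open Set

theorem arcsin_int (p q : ℝ) (hp : 0 ≤ p) (hpq : p < q) :
    IntervalIntegrable (fun y => Real.sqrt ((q - y) * (y - p)) / y) volume p q ∧
    ∫ y in p..q, Real.sqrt ((q - y) * (y - p)) / y = Real.pi * ((p + q) / 2 - Real.sqrt (p * q)) := by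
  have hq : 0 < q := hp.trans_lt hpq
  have hd : 0 < q - p := by linarith
  set c := Real.sqrt (p * q) with hc
  set H : ℝ → ℝ := fun y => c * Real.arcsin (((p+q)*y - 2*p*q) / (y * (q-p))) with hH
  set F : ℝ → ℝ := fun y => Real.sqrt ((q - y) * (y - p)) + (p+q)/2 * Real.arcsin ((2*y - p - q)/(q-p)) - H y with hF
  have hHc : ContinuousOn H (Icc p q) := by
    rcases hp.eq_or_lt with h | h
    · have : H = fun _ => 0 := by
        funext y; simp [hH, hc, ← h]
      rw [this]; exact continuousOn_const
    · refine continuousOn_const.mul (Real.continuous_arcsin.comp_continuousOn ?_)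
      refine ContinuousOn.div (by fun_prop) (by fun_prop) fun y hy => ?_
      have : 0 < y := h.trans_le hy.1
      positivity
  have hcont : ContinuousOn F (Icc p q) := by
    refine ContinuousOn.sub ?_ hHc
    have : Continuous fun y => Real.sqrt ((q - y) * (y - p)) + (p+q)/2 * Real.arcsin ((2*y - p - q)/(q-p)) := by
      have := Real.continuous_arcsin
      fun_prop
    exact this.continuousOn
  have hder : ∀ y ∈ Ioo p q, HasDerivAt F (Real.sqrt ((q - y) * (y - p)) / y) y := by
    intro y hy
    have hy0 : 0 < y := hp.trans_lt hy.1
    have hw2 : 0 < (q - y) * (y - p) := mul_pos (by linarith [hy.2]) (by linarith [hy.1])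
    set w := Real.sqrt ((q - y) * (y - p)) with hw
    have hw0 : 0 < w := Real.sqrt_pos.2 hw2
    have hwsq : w^2 = (q - y) * (y - p) := Real.sq_sqrt hw2.le
    have d1 : HasDerivAt (fun y => Real.sqrt ((q - y) * (y - p))) ((p + q - 2*y) / (2 * w)) y := by
      have : HasDerivAt (fun y => (q - y) * (y - p)) (p + q - 2*y) y := by
        have := ((hasDerivAt_id y).const_sub q).mul ((hasDerivAt_id y).sub_const p)
        refine this.congr_deriv ?_
        simp; ring
      exact this.sqrt hw2.ne'
    have d2 : HasDerivAt (fun y => Real.arcsin ((2*y - p - q)/(q-p))) (1 / w) y := by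
      have hi : HasDerivAt (fun y => (2*y - p - q)/(q-p)) (2/(q-p)) y := by
        have := ((((hasDerivAt_id y).const_mul 2).sub_const p).sub_const q).div_const (q-p)
        simpa using this
      have e : Real.sqrt (1 - ((2*y - p - q)/(q-p))^2) = 2 * w / (q-p) := by
        rw [show 1 - ((2*y - p - q)/(q-p))^2 = (2 * w / (q-p))^2 by
          rw [div_pow, div_pow, mul_pow, hwsq]; field_simp; ring]
        exact Real.sqrt_sq (by positivity)
      have l1 : -1 < (2*y - p - q)/(q-p) := by rw [lt_div_iff₀ hd]; linarith [hy.1]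
      have l2 : (2*y - p - q)/(q-p) < 1 := by rw [div_lt_iff₀ hd]; linarith [hy.2]
      have := (Real.hasDerivAt_arcsin l1.ne' l2.ne).comp y hi
      refine this.congr_deriv ?_
      rw [e]; field_simp
    have d3 : HasDerivAt H (p*q/(y*w)) y := by
      rcases hp.eq_or_lt with h | h
      · have : H = fun _ => 0 := by
          funext y; simp [hH, hc, ← h]
        rw [this, ← h]; simpa using hasDerivAt_const y (0:ℝ)
      · have hc0 : 0 < c := Real.sqrt_pos.2 (by positivity)
        have hc2 : c^2 = p*q := Real.sq_sqrt (by positivity)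
        have hi : HasDerivAt (fun y => ((p+q)*y - 2*p*q) / (y * (q-p))) (2*p*q/(y^2*(q-p))) y := by
          have := ((((hasDerivAt_id y).const_mul (p+q)).sub_const (2*p*q))).div
            ((hasDerivAt_id y).mul_const (q-p)) (by simp only [id]; positivity)
          refine this.congr_deriv ?_
          simp only [id]
          field_simp; ring
        set u := ((p+q)*y - 2*p*q) / (y * (q-p)) with hu
        have e0 : 1 - u^2 = (2 * c * w / (y*(q-p)))^2 := by
          rw [hu, div_pow, div_pow, show (2*c*w)^2 = 4*(p*q)*((q-y)*(y-p)) by rw [← hwsq, ← hc2]; ring]; field_simp; ring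
        have e : Real.sqrt (1 - u^2) = 2 * c * w / (y*(q-p)) := by
          rw [e0]; exact Real.sqrt_sq (by positivity)
        have hpos : 0 < 1 - u^2 := by rw [e0]; positivity
        have l1 : u ≠ -1 := by intro h; rw [h] at hpos; norm_num at hpos
        have l2 : u ≠ 1 := by intro h; rw [h] at hpos; norm_num at hpos
        have := ((Real.hasDerivAt_arcsin l1 l2).comp y hi).const_mul c
        refine this.congr_deriv ?_
        rw [e]; field_simp
    have := (d1.add (d2.const_mul ((p+q)/2))).sub d3
    refine this.congr_deriv ?_
    field_simp
    rw [hwsq]; ring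
  have hii : IntervalIntegrable (fun y => Real.sqrt ((q - y) * (y - p)) / y) volume p q := by
    refine intervalIntegral.intervalIntegrable_deriv_of_nonneg (g := F) (by rwa [uIcc_of_le hpq.le]) ?_ ?_
    · rw [min_eq_left hpq.le, max_eq_right hpq.le]; exact hder
    · rw [min_eq_left hpq.le, max_eq_right hpq.le]
      intro y hy
      have : 0 < y := hp.trans_lt hy.1
      positivity
  refine ⟨hii, ?_⟩
  rw [intervalIntegral.integral_eq_sub_of_hasDerivAt_of_le hpq.le hcont hder hii]
  have F1 : F q = (p+q)/2 * (Real.pi/2) - c * (Real.pi/2) := by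
    simp only [hF, hH]
    rw [show (2*q-p-q)/(q-p) = 1 by field_simp; ring,
      show ((p+q)*q - 2*p*q)/(q*(q-p)) = 1 by field_simp; ring, Real.arcsin_one]
    simp
  have F2 : F p = -((p+q)/2 * (Real.pi/2) - c * (Real.pi/2)) := by
    simp only [hF, hH]
    rw [show (2*p-p-q)/(q-p) = -1 by field_simp; ring]
    rcases hp.eq_or_lt with h | h
    · have : c = 0 := by simp [hc, ← h]
      rw [this]; simp
    · rw [show ((p+q)*p - 2*p*q)/(p*(q-p)) = -1 by field_simp; ring, Real.arcsin_neg_one]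
      simp; ring
  rw [F1, F2]; ring

/-- shifted version -/
theorem arcsin_int_shift (α β t : ℝ) (hα : 0 ≤ α + t) (hab : α < β) :
    IntervalIntegrable (fun x => Real.sqrt ((β - x) * (x - α)) / (x + t)) volume α β ∧
    ∫ x in α..β, Real.sqrt ((β - x) * (x - α)) / (x + t) =
      Real.pi * ((α + β) / 2 + t - Real.sqrt ((α + t) * (β + t))) := by
  obtain ⟨h1, h2⟩ := arcsin_int (α + t) (β + t) hα (by linarith)
  have e : (fun x => Real.sqrt ((β - x) * (x - α)) / (x + t)) =
    fun x => (fun y => Real.sqrt ((β + t - y) * (y - (α + t))) / y) (x + t) := by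
    funext x; simp only; congr 3 <;> ring
  constructor
  · rw [e]
    have := h1.comp_add_right t
    simpa using this
  · rw [e, intervalIntegral.integral_comp_add_right (fun y => Real.sqrt ((β + t - y) * (y - (α + t))) / y), h2]
    ring_nf

end PartMP

section PartMP2
open Set

theorem mp_edges (τ : ℝ) (hτ : 0 < τ) : (1 - Real.sqrt τ)^2 < (1 + Real.sqrt τ)^2 ∧
    (1 - Real.sqrt τ)^2 + (1 + Real.sqrt τ)^2 = 2 * (1 + τ) ∧
    (1 - Real.sqrt τ)^2 * (1 + Real.sqrt τ)^2 = (1 - τ)^2 ∧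
    ∀ x, 4 * τ * x - (x + τ - 1)^2 = ((1 + Real.sqrt τ)^2 - x) * (x - (1 - Real.sqrt τ)^2) := by
  have h0 := Real.sqrt_pos.2 hτ
  have h1 := Real.sq_sqrt hτ.le
  set r := Real.sqrt τ
  refine ⟨by nlinarith, by rw [← h1]; ring, by rw [← h1]; ring, fun x => by rw [← h1]; ring⟩

theorem mpDensity_eq (τ : ℝ) (hτ : 0 < τ) : mpDensity τ =
    (Icc ((1 - Real.sqrt τ)^2) ((1 + Real.sqrt τ)^2)).indicator fun x =>
      (1/(2 * Real.pi * τ)) * (Real.sqrt (((1 + Real.sqrt τ)^2 - x) * (x - (1 - Real.sqrt τ)^2)) / x) := by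
  funext x
  unfold mpDensity indicator
  simp only [mem_Icc, (mp_edges τ hτ).2.2.2 x]
  split_ifs
  · rw [mul_comm (1 / _), div_mul_div_comm, mul_one, mul_comm x]
  · rfl

theorem mpDensity_nn (τ : ℝ) (hτ : 0 < τ) (x : ℝ) : 0 ≤ mpDensity τ x := by
  unfold mpDensity
  split_ifs with h
  · have : 0 ≤ x := (sq_nonneg _).trans h.1
    positivity
  · rfl

theorem mpDensity_meas (τ : ℝ) : Measurable (mpDensity τ) := by
  unfold mpDensity
  refine Measurable.ite (measurableSet_Icc (a := (1 - Real.sqrt τ)^2) (b := (1 + Real.sqrt τ)^2)) ?_ measurable_const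
  fun_prop

theorem mp_mass (τ : ℝ) (hτ : 0 < τ) : Integrable (mpDensity τ) ∧
    ∫ x, mpDensity τ x = (1 + τ - |1 - τ|) / (2 * τ) := by
  obtain ⟨e1, e2, e3, -⟩ := mp_edges τ hτ
  rw [mpDensity_eq τ hτ]
  set α := (1 - Real.sqrt τ)^2
  set β := (1 + Real.sqrt τ)^2
  obtain ⟨h1, h2⟩ := arcsin_int_shift α β 0 (by simp only [add_zero]; exact sq_nonneg _) e1
  simp only [add_zero] at h1 h2
  constructor
  · rw [integrable_indicator_iff measurableSet_Icc]
    rw [intervalIntegrable_iff_integrableOn_Icc_of_le e1.le] at h1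
    exact h1.const_mul _
  · rw [integral_indicator measurableSet_Icc, integral_Icc_eq_integral_Ioc,
      ← intervalIntegral.integral_of_le e1.le, intervalIntegral.integral_const_mul, h2, e2, e3, Real.sqrt_sq_eq_abs]
    have := Real.pi_pos
    field_simp

theorem mp_stieltjes (τ t : ℝ) (hτ : 0 < τ) (ht : 0 < t) :
    ∫ x, mpDensity τ x * (1 / (x + t)) = (Real.sqrt ((1+τ+t)^2 - 4*τ) - t - |1 - τ|) / (2 * τ * t) := by
  obtain ⟨e1, e2, e3, -⟩ := mp_edges τ hτ
  rw [mpDensity_eq τ hτ]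
  set α := (1 - Real.sqrt τ)^2
  set β := (1 + Real.sqrt τ)^2
  have hα : 0 ≤ α := sq_nonneg _
  obtain ⟨h1, h2⟩ := arcsin_int_shift α β 0 (by simpa using hα) e1
  obtain ⟨h3, h4⟩ := arcsin_int_shift α β t (by positivity) e1
  simp only [add_zero] at h1 h2
  have e : ∀ x, ((Icc α β).indicator (fun x => (1/(2 * Real.pi * τ)) * (Real.sqrt ((β - x) * (x - α)) / x)) x)
      * (1 / (x + t)) = (Icc α β).indicator (fun x => (1/(2 * Real.pi * τ)) * (1/t) *
        (Real.sqrt ((β - x) * (x - α)) / x - Real.sqrt ((β - x) * (x - α)) / (x + t))) x := by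
    intro x
    unfold indicator
    split_ifs with h
    · have hx : 0 ≤ x := hα.trans h.1
      rcases hx.eq_or_lt with h0 | h0
      · have : α = 0 := le_antisymm (h0 ▸ h.1) hα
        rw [← h0, this]; simp
      · field_simp; ring
    · simp
  simp only [e]
  rw [integral_indicator measurableSet_Icc, integral_Icc_eq_integral_Ioc,
      ← intervalIntegral.integral_of_le e1.le, intervalIntegral.integral_const_mul,
      intervalIntegral.integral_sub h1 h3, h2, h4, e3, Real.sqrt_sq_eq_abs]
  have : (α + t) * (β + t) = (1+τ+t)^2 - 4*τ := by
    have : (α + t) * (β + t) = α * β + (α + β) * t + t^2 := by ring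
    rw [this, e2, e3]; ring
  rw [this, e2]
  have := Real.pi_pos
  field_simp
  ring

theorem mp_prob (τ : ℝ) (hτ : 0 < τ) : IsProbabilityMeasure (mpMeasure τ) := by
  constructor
  obtain ⟨h1, h2⟩ := mp_mass τ hτ
  have h3 : (volume.withDensity fun x => ENNReal.ofReal (mpDensity τ x)) univ =
      ENNReal.ofReal ((1 + τ - |1 - τ|) / (2 * τ)) := by
    rw [withDensity_apply _ MeasurableSet.univ, Measure.restrict_univ, ← h2,
      ofReal_integral_eq_lintegral_ofReal h1 (Filter.Eventually.of_forall (mpDensity_nn τ hτ))]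
  unfold mpMeasure
  rw [Measure.add_apply, h3]
  split_ifs with h
  · simp only [Measure.smul_apply, measure_univ, smul_eq_mul, mul_one]
    rw [← ENNReal.ofReal_add (div_nonneg (by linarith) hτ.le)
      (by rw [abs_of_neg (by linarith)]; apply div_nonneg <;> linarith), abs_of_neg (by linarith)]
    rw [← ENNReal.ofReal_one]; congr 1; field_simp; ring
  · rw [abs_of_nonneg (by linarith)]
    simp only [Measure.coe_zero, Pi.zero_apply, zero_add]
    rw [← ENNReal.ofReal_one]; congr 1; field_simp; ring

theorem mp_ae (τ : ℝ) (hτ : 0 < τ) : ∀ᵐ x ∂(mpMeasure τ), 0 ≤ x := by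
  have hm : Measurable fun x => ENNReal.ofReal (mpDensity τ x) :=
    ENNReal.measurable_ofReal.comp (mpDensity_meas τ)
  unfold mpMeasure
  rw [ae_add_measure_iff]
  constructor
  · split_ifs
    · refine Measure.ae_smul_measure ?_ _
      rw [ae_dirac_iff (measurableSet_Ici (a := (0:ℝ)))]
    · simp
  · rw [ae_withDensity_iff hm]
    refine Filter.Eventually.of_forall fun x hx => ?_
    by_contra h
    apply hx
    have : mpDensity τ x = 0 := by
      unfold mpDensity
      rw [if_neg]
      intro h2
      exact h ((sq_nonneg _).trans h2.1)
    simp [this]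

theorem mp_res (τ a s : ℝ) (hτ : 0 < τ) (ha : 0 < a) (hs : 0 < s) :
    ∫ x, 1 / (a * x + s) ∂(mpMeasure τ) = resLim τ a s := by
  have hm : Measurable fun x => ENNReal.ofReal (mpDensity τ x) :=
    ENNReal.measurable_ofReal.comp (mpDensity_meas τ)
  have hP := mp_prob τ hτ
  have hae := mp_ae τ hτ
  set t := s / a with ht
  have ht0 : 0 < t := by positivity
  have hI : Integrable (fun x => 1 / (a * x + s)) (mpMeasure τ) := by
    refine (integrable_const (1/s)).mono' (by
      have : Measurable fun x : ℝ => 1 / (a * x + s) := by fun_prop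
      exact this.aestronglyMeasurable) ?_
    filter_upwards [hae] with x hx
    have : 0 < a * x + s := by positivity
    rw [Real.norm_of_nonneg (by positivity)]
    apply one_div_le_one_div_of_le hs
    nlinarith [mul_nonneg ha.le hx]
  have h3 : ∫ x, 1 / (a * x + s) ∂(volume.withDensity fun x => ENNReal.ofReal (mpDensity τ x)) =
      1 / a * ((Real.sqrt ((1+τ+t)^2 - 4*τ) - t - |1 - τ|) / (2 * τ * t)) := by
    rw [integral_withDensity_eq_integral_toReal_smul hm (by simp), ← mp_stieltjes τ t hτ ht0,
      ← integral_const_mul]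
    congr 1
    funext x
    rw [ENNReal.toReal_ofReal (mpDensity_nn τ hτ x), smul_eq_mul]
    have : a * x + s = a * (x + t) := by rw [ht]; field_simp
    rw [this, one_div_mul_eq_div, ← mul_one_div, one_div (a * _), mul_inv]
    ring
  unfold mpMeasure at hI ⊢
  rw [integrable_add_measure] at hI
  rw [integral_add_measure hI.1 hI.2, h3]
  have hs' : s = a * t := by rw [ht]; field_simp
  unfold resLim gst
  rw [← ht, hs']
  split_ifs with h
  · rw [integral_smul_measure, integral_dirac, ENNReal.toReal_ofReal (div_nonneg (by linarith) hτ.le),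
      abs_of_neg (by linarith)]
    simp only [mul_zero, zero_add, smul_eq_mul]
    field_simp
    ring
  · rw [abs_of_nonneg (by linarith)]
    simp only [integral_zero_measure, zero_add]
    field_simp
    ring

end PartMP2

section PartSpec
open Matrix Filter Topology

theorem spec_trace_conj {k : ℕ} {G : Matrix (Fin k) (Fin k) ℝ} (hG : G.IsHermitian) (X : Matrix (Fin k) (Fin k) ℝ) :
    (Unitary.conjStarAlgAut ℝ _ hG.eigenvectorUnitary X).trace = X.trace := by
  rw [Unitary.conjStarAlgAut_apply, Matrix.trace_mul_comm, ← mul_assoc]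
  simp

theorem spec_dec {k : ℕ} {G : Matrix (Fin k) (Fin k) ℝ} (hG : G.IsHermitian) :
    G = Unitary.conjStarAlgAut ℝ _ hG.eigenvectorUnitary (diagonal hG.eigenvalues) :=
  hG.spectral_theorem

theorem spec_pow {k : ℕ} {G : Matrix (Fin k) (Fin k) ℝ} (hG : G.IsHermitian) (m : ℕ) :
    (G ^ m).trace = ∑ i, hG.eigenvalues i ^ m := by
  conv_lhs => rw [spec_dec hG]
  rw [← map_pow, spec_trace_conj, Matrix.diagonal_pow, Matrix.trace_diagonal]
  rfl

theorem spec_rs {k : ℕ} {G : Matrix (Fin k) (Fin k) ℝ} (hG : G.IsHermitian) (hp : G.PosSemidef) {s : ℝ} (hs : 0 < s) :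
    (rs G s).trace = ∑ i, 1 / (hG.eigenvalues i + s) := by
  have h0 : ∀ i, 0 ≤ hG.eigenvalues i := fun i => hp.eigenvalues_nonneg i
  have key : rs G s = Unitary.conjStarAlgAut ℝ _ hG.eigenvectorUnitary
      (diagonal fun i => 1 / (hG.eigenvalues i + s)) := by
    apply Matrix.inv_eq_right_inv
    have e1 : s • (1 : Matrix (Fin k) (Fin k) ℝ) =
        Unitary.conjStarAlgAut ℝ _ hG.eigenvectorUnitary (s • 1) := by
      rw [map_smul, map_one]
    conv_lhs => rw [e1]
    conv_lhs =>
      lhs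
      lhs
      rw [spec_dec hG]
    rw [← map_add, ← map_mul, Matrix.smul_one_eq_diagonal, Matrix.diagonal_add, Matrix.diagonal_mul_diagonal]
    have : (fun i => (hG.eigenvalues i + s) * (1 / (hG.eigenvalues i + s))) = fun _ => 1 := by
      funext i
      have := h0 i
      field_simp
    rw [this, Matrix.diagonal_one, map_one]
  rw [key, spec_trace_conj, Matrix.trace_diagonal]

theorem spec_meas (N k : ℕ) (f : ℝ → ℝ) (hf : Continuous f) :
    Measurable fun μ : Fin k → Fin N → ℝ => ∑ i, f ((gramMatrix_isHermitian μ).eigenvalues i) := by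
  have hp : ∀ n : ℕ, ∃ p : Polynomial ℝ, ∀ x ∈ Set.Icc (-(n:ℝ)) n, |p.eval x - f x| < 1 / ((n:ℝ)+1) :=
    fun n => exists_polynomial_near_of_continuousOn _ _ f hf.continuousOn _ (by positivity)
  choose p hp using hp
  have hm : ∀ n, Measurable fun μ : Fin k → Fin N → ℝ =>
      ∑ i, (p n).eval ((gramMatrix_isHermitian μ).eigenvalues i) := by
    intro n
    have : (fun μ : Fin k → Fin N → ℝ => ∑ i, (p n).eval ((gramMatrix_isHermitian μ).eigenvalues i)) =
        fun μ => ∑ m ∈ Finset.range ((p n).natDegree + 1), (p n).coeff m * (gramMatrix μ ^ m).trace := by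
      funext μ
      simp_rw [Polynomial.eval_eq_sum_range, spec_pow (gramMatrix_isHermitian μ), Finset.mul_sum]
      rw [Finset.sum_comm]
    rw [this]
    apply Continuous.measurable
    refine continuous_finsetSum _ fun m _ => continuous_const.mul ?_
    exact ((gram_cont N k).pow m).matrix_trace
  refine measurable_of_tendsto_metrizable hm (tendsto_pi_nhds.2 fun μ => ?_)
  refine tendsto_finsetSum _ fun i _ => ?_
  set x := (gramMatrix_isHermitian μ).eigenvalues i
  rw [tendsto_iff_dist_tendsto_zero]
  refine squeeze_zero' (Eventually.of_forall fun _ => dist_nonneg) ?_ tendsto_one_div_add_atTop_nhds_zero_nat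
  obtain ⟨n0, hn0⟩ := exists_nat_ge |x|
  filter_upwards [eventually_ge_atTop n0] with n hn
  have : |x| ≤ n := hn0.trans (by exact_mod_cast hn)
  exact (hp n x (abs_le.1 this)).le

end PartSpec

section PartSW
open Filter Topology BoundedContinuousFunction

structure PosLin (L : (ℝ →ᵇ ℝ) → ℝ) : Prop where
  add : ∀ f g, L (f + g) = L f + L g
  smul : ∀ (c : ℝ) f, L (c • f) = c * L f
  nonneg : ∀ f : ℝ →ᵇ ℝ, (∀ x, 0 ≤ x → 0 ≤ f x) → 0 ≤ L f
  one : L 1 = 1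

theorem PosLin.sub {L : (ℝ →ᵇ ℝ) → ℝ} (h : PosLin L) (f g : ℝ →ᵇ ℝ) : L (f - g) = L f - L g := by
  have h1 := h.add (f - g) g
  rw [sub_add_cancel] at h1
  linarith

theorem PosLin.mono {L : (ℝ →ᵇ ℝ) → ℝ} (h : PosLin L) (f g : ℝ →ᵇ ℝ) (hfg : ∀ x, 0 ≤ x → f x ≤ g x) :
    L f ≤ L g := by
  have h1 := h.nonneg (g - f) (fun x hx => by simpa using hfg x hx)
  rw [h.sub] at h1
  linarith

theorem PosLin.bd {L : (ℝ →ᵇ ℝ) → ℝ} (h : PosLin L) (f g : ℝ →ᵇ ℝ) (hfg : ∀ x, 0 ≤ x → |f x| ≤ g x) :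
    |L f| ≤ L g := by
  rw [abs_le]
  constructor
  · have h1 := h.mono ((-1 : ℝ) • g) f (fun x hx => by
      have := (abs_le.1 (hfg x hx)).1
      simpa using this)
    rw [h.smul] at h1
    linarith
  · exact h.mono _ _ fun x hx => (abs_le.1 (hfg x hx)).2

theorem PosLin.near {L : (ℝ →ᵇ ℝ) → ℝ} (h : PosLin L) (f g : ℝ →ᵇ ℝ) (ε : ℝ)
    (hfg : ∀ x, 0 ≤ x → |f x - g x| ≤ ε) : |L f - L g| ≤ ε := by
  rw [← h.sub]
  have := h.bd (f - g) (ε • 1) (fun x hx => by simpa using hfg x hx)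
  rwa [h.smul, h.one, mul_one] at this

noncomputable def hs (s : ℝ) : ℝ →ᵇ ℝ :=
  if h : 0 < s then
    BoundedContinuousFunction.ofNormedAddCommGroup (fun x : ℝ => 1 / (|x| + s))
      (by
        refine continuous_const.div (by fun_prop) fun x => ?_
        have := abs_nonneg x
        linarith) (1 / s)
      (by
        intro x
        have := abs_nonneg x
        rw [Real.norm_of_nonneg (by positivity)]
        exact one_div_le_one_div_of_le h (by linarith))
  else 0

theorem hs_apply {s : ℝ} (h : 0 < s) (x : ℝ) : hs s x = 1 / (|x| + s) := by
  simp [hs, h]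

theorem hs_lim : Tendsto (fun n : ℕ => hs (1 + 1 / ((n:ℝ)+1))) atTop (𝓝 (hs 1)) := by
  rw [tendsto_iff_dist_tendsto_zero]
  refine squeeze_zero (fun _ => dist_nonneg) (fun n => ?_) tendsto_one_div_add_atTop_nhds_zero_nat
  have hn : (0:ℝ) < 1 / ((n:ℝ)+1) := by positivity
  set e := 1 / ((n:ℝ)+1)
  refine (dist_le hn.le).2 fun x => ?_
  rw [hs_apply (by linarith), hs_apply one_pos, Real.dist_eq, abs_sub_comm]
  have := abs_nonneg x
  have e1 : 1 / (|x| + 1) - 1 / (|x| + (1 + e)) = e / ((|x| + 1) * (|x| + (1 + e))) := by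
    field_simp
    ring
  rw [e1, abs_of_nonneg (by positivity)]
  exact div_le_self hn.le (by nlinarith)

noncomputable def WW : Submodule ℝ (ℝ →ᵇ ℝ) :=
  (Submodule.span ℝ ({1} ∪ {f | ∃ s, 0 < s ∧ f = hs s})).topologicalClosure

theorem hs_mem {s : ℝ} (h : 0 < s) : hs s ∈ WW :=
  Submodule.le_topologicalClosure _ (Submodule.subset_span (Or.inr ⟨s, h, rfl⟩))

theorem one_mem_WW : (1 : ℝ →ᵇ ℝ) ∈ WW :=
  Submodule.le_topologicalClosure _ (Submodule.subset_span (Or.inl rfl))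

theorem WW_closed : IsClosed (WW : Set (ℝ →ᵇ ℝ)) := Submodule.isClosed_topologicalClosure _

theorem hs_mul {s : ℝ} (h : 0 < s) (h1 : s ≠ 1) : hs 1 * hs s ∈ WW := by
  have : hs 1 * hs s = (1 / (s - 1)) • (hs 1 - hs s) := by
    ext x
    simp only [BoundedContinuousFunction.mul_apply, BoundedContinuousFunction.smul_apply,
      BoundedContinuousFunction.sub_apply, hs_apply h, hs_apply one_pos, smul_eq_mul]
    have := abs_nonneg x
    have h2 : s - 1 ≠ 0 := sub_ne_zero.2 h1
    field_simp
    ring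
  rw [this]
  exact WW.smul_mem _ (WW.sub_mem (hs_mem one_pos) (hs_mem h))

theorem hs_mul' {s : ℝ} (h : 0 < s) : hs 1 * hs s ∈ WW := by
  by_cases h1 : s = 1
  · subst h1
    refine WW_closed.mem_of_tendsto (hs_lim.const_mul (hs 1)) (Eventually.of_forall fun n => ?_)
    have hn : (0:ℝ) < 1 / ((n:ℝ)+1) := by positivity
    exact hs_mul (by linarith) (by linarith)
  · exact hs_mul h h1

theorem WW_mul (f : ℝ →ᵇ ℝ) (hf : f ∈ WW) : hs 1 * f ∈ WW := by
  have hspan : ∀ g ∈ Submodule.span ℝ ({1} ∪ {f | ∃ s, 0 < s ∧ f = hs s}), hs 1 * g ∈ WW := by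
    intro g hg
    induction hg using Submodule.span_induction with
    | mem x hx =>
      rcases hx with hx | ⟨s, hs0, rfl⟩
      · rw [Set.mem_singleton_iff] at hx
        rw [hx, mul_one]
        exact hs_mem one_pos
      · exact hs_mul' hs0
    | zero => simp
    | add x y _ _ hx hy => rw [mul_add]; exact WW.add_mem hx hy
    | smul c x _ hx => rw [mul_smul_comm]; exact WW.smul_mem _ hx
  have hc : IsClosed {g : ℝ →ᵇ ℝ | hs 1 * g ∈ WW} :=
    WW_closed.preimage (continuous_const.mul continuous_id)
  have hf' : f ∈ closure (Submodule.span ℝ ({1} ∪ {f | ∃ s, 0 < s ∧ f = hs s}) : Set (ℝ →ᵇ ℝ)) := by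
    rw [← Submodule.topologicalClosure_coe]; exact hf
  exact closure_minimal hspan hc hf'

theorem hs_pow (n : ℕ) : hs 1 ^ n ∈ WW := by
  induction n with
  | zero => rw [pow_zero]; exact one_mem_WW
  | succ n ih => rw [pow_succ']; exact WW_mul _ ih

theorem poly_mem (p : Polynomial ℝ) : Polynomial.aeval (hs 1) p ∈ WW := by
  rw [Polynomial.aeval_eq_sum_range]
  exact WW.sum_mem fun i _ => WW.smul_mem _ (hs_pow i)

theorem poly_apply (p : Polynomial ℝ) (x : ℝ) : (Polynomial.aeval (hs 1) p) x = p.eval (hs 1 x) := by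
  rw [Polynomial.aeval_eq_sum_range, Polynomial.eval_eq_sum_range]
  simp [BoundedContinuousFunction.sum_apply]

theorem phi_cont (f : ℝ →ᵇ ℝ) (n : ℝ) (hn : 1 ≤ n) :
    ContinuousOn (fun y : ℝ => f (y⁻¹ - 1) * (n * y / (1 + (n - 1) * y))) (Set.Icc 0 1) := by
  intro y hy
  rcases eq_or_lt_of_le hy.1 with h | h
  · subst h
    unfold ContinuousWithinAt
    simp only [mul_zero, zero_div]
    have hb : Tendsto (fun y : ℝ => ‖f‖ * (n * y)) (𝓝[Set.Icc 0 1] 0) (𝓝 0) := by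
      have : Continuous fun y : ℝ => ‖f‖ * (n * y) := by fun_prop
      have h2 := (this.tendsto 0).mono_left (nhdsWithin_le_nhds (s := Set.Icc 0 1))
      simpa using h2
    refine squeeze_zero_norm' ?_ hb
    filter_upwards [self_mem_nhdsWithin] with y hy
    rw [norm_mul]
    gcongr
    · exact f.norm_coe_le_norm _
    · have h1 : 0 ≤ (n-1) * y := mul_nonneg (by linarith) hy.1
      have h2 : 0 ≤ n * y := mul_nonneg (by linarith) hy.1
      rw [Real.norm_of_nonneg (by positivity)]
      exact div_le_self h2 (by linarith)
  · apply ContinuousAt.continuousWithinAt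
    have h1 : 0 ≤ (n-1) * y := mul_nonneg (by linarith) hy.1
    refine ContinuousAt.mul ?_ ?_
    · exact f.continuous.continuousAt.comp ((continuousAt_inv₀ h.ne').sub continuousAt_const)
    · exact ContinuousAt.div (by fun_prop) (by fun_prop) (by linarith)

theorem sw_main (L : ℕ → (ℝ →ᵇ ℝ) → ℝ) (L0 : (ℝ →ᵇ ℝ) → ℝ) (hL : ∀ N, PosLin (L N)) (hL0 : PosLin L0)
    (hc : ∀ s, 0 < s → Tendsto (fun N => L N (hs s)) atTop (𝓝 (L0 (hs s))))
    (ht : Tendsto (fun n : ℕ => L0 (((n:ℝ)+1) • hs ((n:ℝ)+1))) atTop (𝓝 1)) (f : ℝ →ᵇ ℝ) :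
    Tendsto (fun N => L N f) atTop (𝓝 (L0 f)) := by
  -- approximation principle
  have appr : ∀ f : ℝ →ᵇ ℝ, (∀ ε > 0, ∃ g : ℝ →ᵇ ℝ, Tendsto (fun N => L N g) atTop (𝓝 (L0 g)) ∧
      ∀ x, 0 ≤ x → |f x - g x| ≤ ε) → Tendsto (fun N => L N f) atTop (𝓝 (L0 f)) := by
    intro f h
    rw [Metric.tendsto_atTop]
    intro ε hε
    obtain ⟨g, hg, hfg⟩ := h (ε/4) (by linarith)
    rw [Metric.tendsto_atTop] at hg
    obtain ⟨N0, hN0⟩ := hg (ε/4) (by linarith)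
    refine ⟨N0, fun N hN => ?_⟩
    have h1 := hN0 N hN
    have h2 := (hL N).near f g _ hfg
    have h3 := hL0.near f g _ hfg
    rw [Real.dist_eq] at *
    rw [abs_lt] at *
    rw [abs_le] at h2 h3
    constructor <;> linarith
  let V : Submodule ℝ (ℝ →ᵇ ℝ) :=
    { carrier := {f | Tendsto (fun N => L N f) atTop (𝓝 (L0 f))}
      add_mem' := by
        intro a b ha hb
        simp only [Set.mem_ofPred_eq, (hL _).add, hL0.add] at *
        exact ha.add hb
      zero_mem' := by
        have e : ∀ L : (ℝ →ᵇ ℝ) → ℝ, PosLin L → L 0 = 0 := fun L h => by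
          have := h.smul 0 0
          simpa using this
        simp only [Set.mem_ofPred_eq, e _ (hL _), e _ hL0]
        exact tendsto_const_nhds
      smul_mem' := by
        intro c a ha
        simp only [Set.mem_ofPred_eq, (hL _).smul, hL0.smul] at *
        exact ha.const_mul c }
  have hV : ∀ f, f ∈ V ↔ Tendsto (fun N => L N f) atTop (𝓝 (L0 f)) := fun f => Iff.rfl
  have hspan : Submodule.span ℝ ({1} ∪ {f | ∃ s, 0 < s ∧ f = hs s}) ≤ V := by
    rw [Submodule.span_le]
    rintro g (hg | ⟨s, h0, rfl⟩)
    · rw [Set.mem_singleton_iff] at hg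
      subst hg
      show Tendsto _ _ _
      simp only [(hL _).one, hL0.one]
      exact tendsto_const_nhds
    · exact hc s h0
  have hW : ∀ g ∈ WW, Tendsto (fun N => L N g) atTop (𝓝 (L0 g)) := by
    intro g hg
    apply appr
    intro ε hε
    have hg' : g ∈ closure (Submodule.span ℝ ({1} ∪ {f | ∃ s, 0 < s ∧ f = hs s}) : Set (ℝ →ᵇ ℝ)) := by
      rw [← Submodule.topologicalClosure_coe]; exact hg
    obtain ⟨b, hb, hd⟩ := Metric.mem_closure_iff.1 hg' ε hε
    exact ⟨b, hspan hb, fun x _ => by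
      rw [← Real.dist_eq]
      exact (dist_coe_le_dist x).trans hd.le⟩
  have hfn : ∀ n : ℕ, Tendsto (fun N => L N (f * (((n:ℝ)+1) • hs ((n:ℝ)+1)))) atTop
      (𝓝 (L0 (f * (((n:ℝ)+1) • hs ((n:ℝ)+1))))) := by
    intro n
    apply appr
    intro ε hε
    have hn0 : (0:ℝ) ≤ n := n.cast_nonneg
    obtain ⟨p, hp⟩ := exists_polynomial_near_of_continuousOn _ _ _ (phi_cont f ((n:ℝ)+1) (by linarith)) ε hε
    refine ⟨_, hW _ (poly_mem p), fun x hx => ?_⟩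
    rw [poly_apply, abs_sub_comm]
    have hx1 : hs 1 x = (x+1)⁻¹ := by rw [hs_apply one_pos, abs_of_nonneg hx, one_div]
    have := hp (hs 1 x) (by
      rw [hx1]
      exact ⟨by positivity, inv_le_one_of_one_le₀ (by linarith)⟩)
    refine le_of_eq_of_le ?_ this.le
    congr 2
    rw [BoundedContinuousFunction.mul_apply, BoundedContinuousFunction.smul_apply, hs_apply (by positivity),
      hx1, abs_of_nonneg hx, inv_inv, add_sub_cancel_right, smul_eq_mul]
    congr 1
    have e1 : 1 + ((n:ℝ) + 1 - 1) * (x+1)⁻¹ = (x + (n + 1)) * (x+1)⁻¹ := by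
      field_simp
      ring
    rw [e1, mul_div_mul_right _ _ (by positivity), mul_one_div]
  -- final
  set q : ℕ → (ℝ →ᵇ ℝ) := fun n => ((n:ℝ)+1) • hs ((n:ℝ)+1) with hq
  have hq1 : ∀ n x, q n x ≤ 1 := by
    intro n x
    have h0 := abs_nonneg x
    simp only [hq, BoundedContinuousFunction.smul_apply, smul_eq_mul]
    rw [hs_apply (by positivity), mul_one_div]
    exact div_le_one_of_le₀ (by linarith) (by positivity)
  have hdiff : ∀ (M : (ℝ →ᵇ ℝ) → ℝ), PosLin M → ∀ n, |M f - M (f * q n)| ≤ ‖f‖ * (1 - M (q n)) := by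
    intro M hM n
    rw [← hM.sub]
    refine (hM.bd _ (‖f‖ • (1 - q n)) fun x _ => ?_).trans_eq ?_
    · simp only [BoundedContinuousFunction.sub_apply, BoundedContinuousFunction.mul_apply,
        BoundedContinuousFunction.smul_apply, smul_eq_mul, BoundedContinuousFunction.coe_one, Pi.one_apply]
      have e : f x - f x * q n x = f x * (1 - q n x) := by ring
      rw [e, abs_mul, abs_of_nonneg (by linarith [hq1 n x] : 0 ≤ 1 - q n x)]
      exact mul_le_mul_of_nonneg_right (f.norm_coe_le_norm x) (by linarith [hq1 n x])
    · rw [hM.smul, hM.sub, hM.one]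
  have hqc : ∀ n, Tendsto (fun N => L N (q n)) atTop (𝓝 (L0 (q n))) := by
    intro n
    simp only [hq, (hL _).smul, hL0.smul]
    exact (hc _ (by positivity)).const_mul _
  rw [Metric.tendsto_atTop]
  intro ε hε
  have hT : Tendsto (fun n => ‖f‖ * (1 - L0 (q n))) atTop (𝓝 0) := by
    have := (ht.const_sub 1).const_mul ‖f‖
    simpa using this
  obtain ⟨n, hn⟩ := ((tendsto_order.1 hT).2 (ε/4) (by linarith)).exists
  have hT2 : Tendsto (fun N => ‖f‖ * (1 - L N (q n))) atTop (𝓝 (‖f‖ * (1 - L0 (q n)))) :=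
    ((hqc n).const_sub 1).const_mul _
  have ev1 := (tendsto_order.1 hT2).2 (ε/4) hn
  have ev2 := (Metric.tendsto_nhds.1 (hfn n)) (ε/4) (by linarith)
  obtain ⟨N0, hN0⟩ := eventually_atTop.1 (ev1.and ev2)
  refine ⟨N0, fun N hN => ?_⟩
  obtain ⟨h1, h2⟩ := hN0 N hN
  have h3 := hdiff (L N) (hL N) n
  have h4 := hdiff L0 hL0 n
  change dist (L N (f * q n)) (L0 (f * q n)) < ε / 4 at h2
  rw [Real.dist_eq] at *
  rw [abs_lt] at *
  rw [abs_le] at h3 h4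
  constructor <;> linarith

end PartSW

section PartFin
open Matrix Filter Topology BoundedContinuousFunction

theorem emp_integrable (n k : ℕ) (f : ℝ →ᵇ ℝ) :
    Integrable (fun μ : Fin k → (Fin (n+1) → ℝ) =>
      (1 / (k : ℝ)) * ∑ i, f ((gramMatrix_isHermitian μ).eigenvalues i))
      (Measure.pi fun _ : Fin k => uniformSimplex (n+1)) := by
  have := uniformSimplex_prob n
  refine Integrable.const_mul ?_ _
  refine Integrable.of_bound (spec_meas (n+1) k f f.continuous).aestronglyMeasurable (k * ‖f‖)
    (Eventually.of_forall fun μ => ?_)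
  refine (norm_sum_le _ _).trans ((Finset.sum_le_sum fun i _ => f.norm_coe_le_norm _).trans ?_)
  simp

noncomputable def Lemp (N k : ℕ) (f : ℝ →ᵇ ℝ) : ℝ :=
  ∫ μ : Fin k → (Fin N → ℝ), (1 / (k : ℝ)) * ∑ i, f ((gramMatrix_isHermitian μ).eigenvalues i)
    ∂(Measure.pi fun _ : Fin k => uniformSimplex N)

theorem pi_psd_ae (n k : ℕ) : ∀ᵐ μ ∂(Measure.pi fun _ : Fin k => uniformSimplex (n+1)),
    (gramMatrix μ).PosSemidef := by
  filter_upwards [pi_simplex_ae n k] with μ hμ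
  exact gram_psd n k μ fun i α => (hμ i).1 α

theorem Lemp_pos (n k : ℕ) (hk : 0 < k) : PosLin (Lemp (n+1) k) := by
  have := uniformSimplex_prob n
  have hk' : (0:ℝ) < k := by exact_mod_cast hk
  refine ⟨fun f g => ?_, fun c f => ?_, fun f hf => ?_, ?_⟩
  · unfold Lemp
    rw [← integral_add (emp_integrable n k f) (emp_integrable n k g)]
    congr 1
    funext μ
    simp only [BoundedContinuousFunction.add_apply, Finset.sum_add_distrib, mul_add]
  · unfold Lemp
    rw [← integral_const_mul]
    congr 1
    funext μ
    simp only [BoundedContinuousFunction.smul_apply, smul_eq_mul, ← Finset.mul_sum]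
    ring
  · apply integral_nonneg_of_ae
    filter_upwards [pi_psd_ae n k] with μ hμ
    refine mul_nonneg (by positivity) (Finset.sum_nonneg fun i _ => hf _ ?_)
    exact hμ.eigenvalues_nonneg i
  · unfold Lemp
    have : ∀ μ : Fin k → (Fin (n+1) → ℝ),
        (1 / (k : ℝ)) * ∑ i, (1 : ℝ →ᵇ ℝ) ((gramMatrix_isHermitian μ).eigenvalues i) = 1 := by
      intro μ
      simp [hk'.ne']
    simp_rw [this]
    simp

theorem Lemp_hs (n k : ℕ) {s : ℝ} (h : 0 < s) : Lemp (n+1) k (hs s) =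
    ∫ μ : Fin k → (Fin (n+1) → ℝ), 1 / (k : ℝ) * (rs (gramMatrix μ) s).trace
      ∂(Measure.pi fun _ : Fin k => uniformSimplex (n+1)) := by
  apply integral_congr_ae
  filter_upwards [pi_psd_ae n k] with μ hμ
  rw [spec_rs (gramMatrix_isHermitian μ) hμ h]
  congr 1
  refine Finset.sum_congr rfl fun i _ => ?_
  rw [hs_apply h, abs_of_nonneg (hμ.eigenvalues_nonneg i)]

noncomputable def Lmp (τ a : ℝ) (f : ℝ →ᵇ ℝ) : ℝ := ∫ x, f (a * x) ∂(mpMeasure τ)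

theorem mp_integrable (τ : ℝ) (hτ : 0 < τ) (a : ℝ) (f : ℝ →ᵇ ℝ) :
    Integrable (fun x => f (a * x)) (mpMeasure τ) := by
  have := mp_prob τ hτ
  refine Integrable.of_bound (f.continuous.comp (continuous_const.mul continuous_id)).aestronglyMeasurable ‖f‖
    (Eventually.of_forall fun x => f.norm_coe_le_norm _)

theorem Lmp_pos (τ : ℝ) (hτ : 0 < τ) (a : ℝ) (ha : 0 < a) : PosLin (Lmp τ a) := by
  have := mp_prob τ hτ
  refine ⟨fun f g => ?_, fun c f => ?_, fun f hf => ?_, ?_⟩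
  · unfold Lmp
    rw [← integral_add (mp_integrable τ hτ a f) (mp_integrable τ hτ a g)]
    rfl
  · unfold Lmp
    rw [← integral_const_mul]
    rfl
  · apply integral_nonneg_of_ae
    filter_upwards [mp_ae τ hτ] with x hx
    exact hf _ (mul_nonneg ha.le hx)
  · unfold Lmp
    simp

theorem Lmp_hs (τ : ℝ) (hτ : 0 < τ) (a : ℝ) (ha : 0 < a) {s : ℝ} (h : 0 < s) :
    Lmp τ a (hs s) = resLim τ a s := by
  rw [← mp_res τ a s hτ ha h]
  apply integral_congr_ae
  filter_upwards [mp_ae τ hτ] with x hx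
  rw [hs_apply h, abs_of_nonneg (mul_nonneg ha.le hx)]

theorem Lmp_tight (τ : ℝ) (hτ : 0 < τ) (a : ℝ) :
    Tendsto (fun n : ℕ => Lmp τ a (((n:ℝ)+1) • hs ((n:ℝ)+1))) atTop (𝓝 1) := by
  have := mp_prob τ hτ
  have h1 : (1:ℝ) = ∫ _x, (1:ℝ) ∂(mpMeasure τ) := by simp
  unfold Lmp
  suffices h : Tendsto (fun n : ℕ => ∫ x, (((n:ℝ)+1) • hs ((n:ℝ)+1)) (a * x) ∂(mpMeasure τ)) atTop
      (𝓝 (∫ _x, (1:ℝ) ∂(mpMeasure τ))) by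
    rwa [← h1] at h
  refine tendsto_integral_of_dominated_convergence (fun _ => 1)
    (fun n => (mp_integrable τ hτ a _).aestronglyMeasurable) (integrable_const _)
    (fun n => Eventually.of_forall fun x => ?_) (Eventually.of_forall fun x => ?_)
  · have h0 := abs_nonneg (a * x)
    rw [BoundedContinuousFunction.smul_apply, hs_apply (by positivity), smul_eq_mul, mul_one_div,
      Real.norm_of_nonneg (by positivity)]
    exact div_le_one_of_le₀ (by linarith) (by positivity)
  · have h0 := abs_nonneg (a * x)
    have e : ∀ n : ℕ, (((n:ℝ)+1) • hs ((n:ℝ)+1)) (a * x) = 1 - |a*x| * (1 / (|a * x| + ((n:ℝ)+1))) := by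
      intro n
      rw [BoundedContinuousFunction.smul_apply, hs_apply (by positivity), smul_eq_mul]
      field_simp
      ring
    refine Tendsto.congr (fun n => (e n).symm) ?_
    have h2 : Tendsto (fun n : ℕ => 1 / (|a * x| + ((n:ℝ)+1))) atTop (𝓝 0) := by
      refine squeeze_zero (fun n => by positivity) (fun n => ?_) tendsto_one_div_add_atTop_nhds_zero_nat
      exact one_div_le_one_div_of_le (by positivity) (by linarith)
    have h3 := (h2.const_mul |a*x|).const_sub 1
    simpa using h3

end PartFin

theorem stmt5 (τ : ℝ) (hτ : 0 < τ) (K : ℕ → ℕ)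
    (hK : Filter.Tendsto (fun N => (K N : ℝ) / N) Filter.atTop (nhds τ))
    (a : ℝ) (ha : a = 1 - Real.pi / 4)
    (f : ℝ → ℝ) (hf : Continuous f) (hfb : ∃ M, ∀ x, |f x| ≤ M) :
    Filter.Tendsto
      (fun N =>
        ∫ μ : Fin (K N) → (Fin N → ℝ),
          (1 / (K N : ℝ)) * ∑ i, f ((gramMatrix_isHermitian μ).eigenvalues i)
          ∂(Measure.pi fun _ : Fin (K N) => uniformSimplex N))
      Filter.atTop (nhds (∫ x, f (a * x) ∂(mpMeasure τ))) := by
  obtain ⟨M, hM⟩ := hfb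
  have ha0 : 0 < a := ha ▸ quarter_pos
  obtain ⟨N0, hN0⟩ := Filter.eventually_atTop.1 (K_pos_ev τ hτ K hK)
  let F := BoundedContinuousFunction.ofNormedAddCommGroup f hf M hM
  rw [← Filter.tendsto_add_atTop_iff_nat (N0 + 1)]
  refine sw_main (fun N => Lemp (N + (N0 + 1)) (K (N + (N0 + 1)))) (Lmp τ a) (fun N => ?_)
    (Lmp_pos τ hτ a ha0) (fun s h => ?_) (Lmp_tight τ hτ a) F
  · exact Lemp_pos (N + N0) _ (hN0 _ (by omega))
  · rw [Lmp_hs τ hτ a ha0 h]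
    have h1 := (Filter.tendsto_add_atTop_iff_nat (N0 + 1)).2 (res_conv τ hτ K hK s h)
    rw [← ha] at h1
    refine h1.congr fun N => ?_
    exact (Lemp_hs (N + N0) (K (N + (N0 + 1))) h).symm
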